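/- There is a constant C (depending only on b, c_+, c_- and the fixed cutoff functions) such that for all p∈[1,2], all integers ℓ≥1, all j∈ℤ, all u>0, and all Schwartz functions f on ℝ², ‖A_{j,ℓ}^u f‖_{L^p(ℝ²)} ≤ C 2^{-ℓ(1-1/p)} ‖f‖_{L^p(ℝ²)}. -/

import Mathlib

open MeasureTheory Filter Set Topology
open scoped ENNReal NNReal Topology Classical

noncomputable section

/-- The homogeneous curve of degree `b`: `γ_b(t) = c₊ t^b` for `t > 0`,
`γ_b(t) = c₋ (-t)^b` for `t < 0`, `γ_b(0) = 0`. -/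
def curve (b cp cm t : ℝ) : ℝ :=
  if 0 < t then cp * t ^ b else if t < 0 then cm * (-t) ^ b else 0

/-- The maximal function along the curve `(t, u γ_b(t))`. -/
def Mu (b cp cm u : ℝ) (f : ℝ × ℝ → ℝ) (x : ℝ × ℝ) : ℝ :=
  ⨆ R : {R : ℝ // 0 < R},
    ((R : ℝ))⁻¹ * ∫ t in (0:ℝ)..(R : ℝ), |f (x - (t, u * curve b cp cm t))|

/-- The maximal function `𝓜^U f = sup_{u ∈ U} M^{(u)} f`. -/
def calM (b cp cm : ℝ) (U : Set ℝ) (f : ℝ × ℝ → ℝ) (x : ℝ × ℝ) : ℝ :=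
  ⨆ u : U, Mu b cp cm (u : ℝ) f x

/-- The Hilbert transform along the curve `(t, u γ_b(t))` (principal value). -/
def Hu (b cp cm u : ℝ) (f : ℝ × ℝ → ℝ) (x : ℝ × ℝ) : ℝ :=
  limUnder (𝓝[>] (0:ℝ)) fun ε : ℝ =>
    ∫ t in {t : ℝ | ε < |t| ∧ |t| < ε⁻¹}, f (x - (t, u * curve b cp cm t)) / t

/-- The maximal function `𝓗^U f = sup_{u ∈ U} |H^{(u)} f|`, valued in `ℝ≥0∞`. -/
def calH (b cp cm : ℝ) (U : Set ℝ) (f : ℝ × ℝ → ℝ) (x : ℝ × ℝ) : ℝ≥0∞ :=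
  ⨆ u : U, ENNReal.ofReal |Hu b cp cm (u : ℝ) f x|

/-- The `L^p` norm of an `ℝ≥0∞`-valued function on `ℝ²`. -/
def lpN (g : ℝ × ℝ → ℝ≥0∞) (p : ℝ) : ℝ≥0∞ :=
  (∫⁻ x : ℝ × ℝ, g x ^ p) ^ (1 / p)

def eN (p : ℝ) : ℝ≥0∞ := ENNReal.ofReal p

/-- `U^r = r⁻¹ U ∩ [1,2] = {ρ ∈ [1,2] : rρ ∈ U}`. -/
def UrSet (U : Set ℝ) (r : ℝ) : Set ℝ := {ρ : ℝ | ρ ∈ Icc (1:ℝ) 2 ∧ r * ρ ∈ U}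

/-- `N(A,δ)`: minimal number of intervals of length `δ` needed to cover `A`. -/
def covN (A : Set ℝ) (δ : ℝ) : ℕ :=
  sInf {n : ℕ | ∃ F : Finset ℝ, F.card = n ∧ A ⊆ ⋃ a ∈ F, Icc a (a + δ)}

/-- `𝒦_p(U,δ) = δ^{1-1/p} sup_{r>0} N(U^r,δ)^{1/p}`. -/
def Kp (U : Set ℝ) (δ p : ℝ) : ℝ :=
  δ ^ (1 - 1 / p) * ⨆ r : {r : ℝ // 0 < r}, ((covN (UrSet U (r : ℝ)) δ : ℝ)) ^ (1 / p)

/-- `p_cr(U) = 1 + limsup_{δ→0+} sup_{r>0} log N(U^r,δ) / log(1/δ)`. -/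
def pcr (U : Set ℝ) : ℝ :=
  1 + limsup (fun δ : ℝ =>
      (⨆ r : {r : ℝ // 0 < r}, Real.log (covN (UrSet U (r : ℝ)) δ)) / Real.log δ⁻¹)
    (𝓝[>] (0:ℝ))

/-- `𝔑(U) = 1 + #{n ∈ ℤ : [2ⁿ, 2ⁿ⁺¹] ∩ U ≠ ∅}`. -/
def frakN (U : Set ℝ) : ℕ∞ :=
  1 + Set.encard {n : ℤ | (Icc ((2:ℝ) ^ n) ((2:ℝ) ^ (n + 1)) ∩ U).Nonempty}

/-- `√(log 𝔑(U))`, valued in `ℝ≥0∞` (equal to `∞` if `𝔑(U) = ∞`). -/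
def sqrtLogN (U : Set ℝ) : ℝ≥0∞ :=
  if frakN U = ⊤ then ⊤
  else ENNReal.ofReal (Real.sqrt (Real.log ((frakN U).toNat : ℝ)))

/-- The `L^p → L^p` operator norm of `𝓜^U` (smallest admissible constant, possibly `∞`). -/
def opNormM (b cp cm : ℝ) (U : Set ℝ) (p : ℝ) : ℝ≥0∞ :=
  sInf {C : ℝ≥0∞ | ∀ f : SchwartzMap (ℝ × ℝ) ℝ,
    eLpNorm (calM b cp cm U ⇑f) (eN p) volume ≤ C * eLpNorm ⇑f (eN p) volume}

/-- The `L^p → L^p` operator norm of `𝓗^U` (smallest admissible constant, possibly `∞`). -/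
def opNormH (b cp cm : ℝ) (U : Set ℝ) (p : ℝ) : ℝ≥0∞ :=
  sInf {C : ℝ≥0∞ | ∀ f : SchwartzMap (ℝ × ℝ) ℝ,
    lpN (calH b cp cm U ⇑f) p ≤ C * eLpNorm ⇑f (eN p) volume}

/-- `θ_{p,ℓ}`. -/
def theta (p : ℝ) (l : ℕ) : ℝ :=
  if (l : ℝ) ≤ (p - 1)⁻¹ then (p - 1) ^ (3 - 10 / p) else (l : ℝ) ^ (7 * (2 / p - 1))

/-- `Σ_{ℓ≥1} θ_{p,ℓ} 𝒦_p(U, 2^{-ℓ})`, valued in `ℝ≥0∞`. -/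
def KpSum (U : Set ℝ) (p : ℝ) : ℝ≥0∞ :=
  ∑' l : ℕ, ENNReal.ofReal (theta p (l + 1) * Kp U ((2:ℝ) ^ (-((l : ℝ) + 1))) p)



/-- The Fourier transform on `ℝ²`. -/
def FT (f : ℝ × ℝ → ℂ) (ξ : ℝ × ℝ) : ℂ :=
  ∫ x : ℝ × ℝ,
    Complex.exp ((((-(2 * Real.pi * (x.1 * ξ.1 + x.2 * ξ.2))) : ℝ) : ℂ) * Complex.I) * f x

/-- The inverse Fourier transform on `ℝ²`. -/
def FTinv (g : ℝ × ℝ → ℂ) (x : ℝ × ℝ) : ℂ :=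
  ∫ ξ : ℝ × ℝ,
    Complex.exp (((2 * Real.pi * (x.1 * ξ.1 + x.2 * ξ.2) : ℝ) : ℂ) * Complex.I) * g ξ

/-- `τ̂₀(ξ) = ∫ e^{-2πi(ξ₁t + ξ₂γ_b(t))} χ₊(t) dt`. -/
def tauHat (b cp cm : ℝ) (χp : ℝ → ℝ) (ξ : ℝ × ℝ) : ℂ :=
  ∫ t : ℝ,
    Complex.exp ((((-(2 * Real.pi * (ξ.1 * t + ξ.2 * curve b cp cm t))) : ℝ) : ℂ) * Complex.I)
      * ((χp t : ℝ) : ℂ)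

/-- `σ̂(ξ) = ∫ e^{-2πi(ξ₁t + ξ₂γ_b(t))} χ(t) dt/t` for a cutoff `χ`. -/
def sigmaHat (b cp cm : ℝ) (χ : ℝ → ℝ) (ξ : ℝ × ℝ) : ℂ :=
  ∫ t : ℝ,
    Complex.exp ((((-(2 * Real.pi * (ξ.1 * t + ξ.2 * curve b cp cm t))) : ℝ) : ℂ) * Complex.I)
      * ((χ t / t : ℝ) : ℂ)

/-- `ρ̂₀(ξ) = (1-η₀(ξ)) ς₋(ξ₁/(c₊ξ₂)) τ̂₀(ξ)`. -/
def rhoHat (b cp cm : ℝ) (χp : ℝ → ℝ) (η : ℝ × ℝ → ℝ) (ςm : ℝ → ℝ) (ξ : ℝ × ℝ) : ℂ :=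
  (((1 - η ξ) * ςm (ξ.1 / (cp * ξ.2)) : ℝ) : ℂ) * tauHat b cp cm χp ξ

/-- `μ̂_{0,±}`; `sgn = true` is the `+` sign. -/
def muHat (b cp cm : ℝ) (χp : ℝ → ℝ) (η : ℝ × ℝ → ℝ) (ςp ςm : ℝ → ℝ) (sgn : Bool)
    (ξ : ℝ × ℝ) : ℂ :=
  if sgn then
    (((1 - η ξ) * ςm (ξ.1 / (cp * ξ.2)) : ℝ) : ℂ) * sigmaHat b cp cm χp ξ
  else
    (((1 - η ξ) * ςp (ξ.1 / (cm * ξ.2)) : ℝ) : ℂ) * sigmaHat b cp cm (fun t => χp (-t)) ξ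

/-- `ζ_ℓ(ξ) = ζ₀(2^{-ℓ}ξ) - ζ₀(2^{1-ℓ}ξ)`. -/
def zl (ζ : ℝ × ℝ → ℝ) (l : ℕ) (ξ : ℝ × ℝ) : ℝ :=
  ζ ((2:ℝ) ^ (-(l : ℝ)) • ξ) - ζ ((2:ℝ) ^ (1 - (l : ℝ)) • ξ)

/-- The anisotropic dilation `ξ ↦ (2^{-j}ξ₁, 2^{-jb} u ξ₂)`. -/
def dil (b : ℝ) (j : ℤ) (u : ℝ) (ξ : ℝ × ℝ) : ℝ × ℝ :=
  ((2:ℝ) ^ (-(j : ℝ)) * ξ.1, (2:ℝ) ^ (-((j : ℝ) * b)) * (u * ξ.2))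

/-- `A_{j,ℓ}^u`, defined via `(A_{j,ℓ}^u f)^(ξ) = ζ_ℓ(...) ρ̂₀(...) f̂(ξ)`. -/
def Ajl (b cp cm : ℝ) (χp : ℝ → ℝ) (η : ℝ × ℝ → ℝ) (ςm : ℝ → ℝ) (ζ : ℝ × ℝ → ℝ)
    (j : ℤ) (l : ℕ) (u : ℝ) (f : ℝ × ℝ → ℝ) : ℝ × ℝ → ℂ :=
  FTinv fun ξ =>
    ((zl ζ l (dil b j u ξ) : ℝ) : ℂ) * rhoHat b cp cm χp η ςm (dil b j u ξ)
      * FT (fun x => ((f x : ℝ) : ℂ)) ξ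

/-- `T_{j,ℓ,±}^u`, defined via `(T_{j,ℓ,±}^u f)^(ξ) = ζ_ℓ(...) μ̂_{0,±}(...) f̂(ξ)`. -/
def Tjl (b cp cm : ℝ) (χp : ℝ → ℝ) (η : ℝ × ℝ → ℝ) (ςp ςm : ℝ → ℝ) (ζ : ℝ × ℝ → ℝ)
    (sgn : Bool) (j : ℤ) (l : ℕ) (u : ℝ) (f : ℝ × ℝ → ℝ) : ℝ × ℝ → ℂ :=
  FTinv fun ξ =>
    ((zl ζ l (dil b j u ξ) : ℝ) : ℂ) * muHat b cp cm χp η ςp ςm sgn (dil b j u ξ)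
      * FT (fun x => ((f x : ℝ) : ℂ)) ξ

/-- `φ̂₀(ξ) = η₀(ξ)τ̂₀(ξ) + (1-η₀(ξ))(1-ς₋(ξ₁/(c₊ξ₂)))τ̂₀(ξ)` (maximal-function version). -/
def phiHatTau (b cp cm : ℝ) (χp : ℝ → ℝ) (η : ℝ × ℝ → ℝ) (ςm : ℝ → ℝ) (ξ : ℝ × ℝ) : ℂ :=
  ((η ξ + (1 - η ξ) * (1 - ςm (ξ.1 / (cp * ξ.2))) : ℝ) : ℂ) * tauHat b cp cm χp ξ

/-- `A_{j,0}^u`, defined via `(A_{j,0}^u f)^(ξ) = φ̂₀(2^{-j}ξ₁, 2^{-jb}uξ₂) f̂(ξ)`. -/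
def Aj0 (b cp cm : ℝ) (χp : ℝ → ℝ) (η : ℝ × ℝ → ℝ) (ςm : ℝ → ℝ)
    (j : ℤ) (u : ℝ) (f : ℝ × ℝ → ℝ) : ℝ × ℝ → ℂ :=
  FTinv fun ξ => phiHatTau b cp cm χp η ςm (dil b j u ξ) * FT (fun x => ((f x : ℝ) : ℂ)) ξ

/-- `φ̂₀(ξ)` (Hilbert-transform version, built from `σ̂_±`). -/
def phiHatSigma (b cp cm : ℝ) (χp : ℝ → ℝ) (η : ℝ × ℝ → ℝ) (ςp ςm : ℝ → ℝ)
    (ξ : ℝ × ℝ) : ℂ :=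
  ((η ξ : ℝ) : ℂ) * (sigmaHat b cp cm χp ξ + sigmaHat b cp cm (fun t => χp (-t)) ξ)
    + (((1 - η ξ) * (1 - ςm (ξ.1 / (cp * ξ.2))) : ℝ) : ℂ) * sigmaHat b cp cm χp ξ
    + (((1 - η ξ) * (1 - ςp (ξ.1 / (cm * ξ.2))) : ℝ) : ℂ)
        * sigmaHat b cp cm (fun t => χp (-t)) ξ

/-- `S^{(u)}`, defined via `(S^{(u)} f)^(ξ) = Σ_j φ̂₀(2^{-j}ξ₁, 2^{-jb}uξ₂) f̂(ξ)`. -/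
def Sop (b cp cm : ℝ) (χp : ℝ → ℝ) (η : ℝ × ℝ → ℝ) (ςp ςm : ℝ → ℝ)
    (u : ℝ) (f : ℝ × ℝ → ℝ) : ℝ × ℝ → ℂ :=
  FTinv fun ξ =>
    (∑' j : ℤ, phiHatSigma b cp cm χp η ςp ςm (dil b j u ξ)) * FT (fun x => ((f x : ℝ) : ℂ)) ξ

/-- The convolution `τ_j^u * f`. -/
def tauConv (b cp cm : ℝ) (χp : ℝ → ℝ) (j : ℤ) (u : ℝ) (f : ℝ × ℝ → ℝ) (x : ℝ × ℝ) : ℝ :=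
  ∫ t : ℝ, f (x - (t, u * curve b cp cm t)) * ((2:ℝ) ^ j * χp ((2:ℝ) ^ j * t))

/-- The `ℓ^p(ℕ)` norm of a sequence. -/
def wNorm (w : ℕ → ℂ) (p : ℝ) : ℝ≥0∞ :=
  (∑' i : ℕ, ENNReal.ofReal (‖w i‖ ^ p)) ^ (1 / p)

/-- The auxiliary maximal operator `𝔐_R[f,w]`. -/
def MfrakR (b cp cm : ℝ) (χp : ℝ → ℝ) (s : ℤ → ℕ → ℝ) (R : ℕ)
    (f : ℝ × ℝ → ℝ) (w : ℤ → ℕ → ℂ) (x : ℝ × ℝ) : ℝ≥0∞ :=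
  ⨆ (j : ℤ) (_ : -(R:ℤ) ≤ j ∧ j ≤ R) (n : ℤ) (_ : -(R:ℤ) ≤ n ∧ n ≤ R) (i : ℕ),
    ENNReal.ofReal
      (‖w n i‖ * |tauConv b cp cm χp j ((2:ℝ) ^ (b * (n : ℝ)) * s n i) f x|)

/-- `B_p(R)`: the best constant in `‖𝔐_R[f,w]‖_p ≤ C (sup_n ‖w_n‖_{ℓ^p}) ‖f‖_p`. -/
def BpR (b cp cm : ℝ) (χp : ℝ → ℝ) (s : ℤ → ℕ → ℝ) (p : ℝ) (R : ℕ) : ℝ≥0∞ :=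
  ⨆ (f : SchwartzMap (ℝ × ℝ) ℝ) (w : ℤ → ℕ → ℂ)
    (_ : eLpNorm ⇑f (eN p) volume ≤ 1) (_ : ∀ n : ℤ, wNorm (w n) p ≤ 1),
    lpN (MfrakR b cp cm χp s R ⇑f w) p

/-- `ℓ^q` norm (over an index type) of an `ℝ≥0∞`-valued family, `q ∈ (0,∞]`. -/
def lqS {ι : Type*} (q : ℝ≥0∞) (g : ι → ℝ≥0∞) : ℝ≥0∞ :=
  if q = ⊤ then ⨆ i, g i else (∑' i, g i ^ q.toReal) ^ (1 / q.toReal)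

/-- The quotient `p/q`, with the convention `p/∞ = 0`. -/
def pqr (p : ℝ) (q : ℝ≥0∞) : ℝ := if q = ⊤ then 0 else p / q.toReal

/-- Schwartz functions on `ℝ × ℝ` transported to the inner product space `ℂ`. -/
def schwartzToComplex (F : SchwartzMap (ℝ × ℝ) ℂ) : SchwartzMap ℂ ℂ :=
  SchwartzMap.compCLMOfContinuousLinearEquiv ℂ Complex.equivRealProdCLM F

/-- Schwartz functions on the inner product space `ℂ` transported to `ℝ × ℝ`. -/
def schwartzOfComplex (F : SchwartzMap ℂ ℂ) : SchwartzMap (ℝ × ℝ) ℂ :=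
  SchwartzMap.compCLMOfContinuousLinearEquiv ℂ Complex.equivRealProdCLM.symm F

theorem integral_comp_equivRealProd {E : Type*} [NormedAddCommGroup E] [NormedSpace ℝ E]
    (g : ℝ × ℝ → E) : ∫ z : ℂ, g (z.re, z.im) = ∫ x, g x :=
  Complex.volume_preserving_equiv_real_prod.integral_comp
    Complex.measurableEquivRealProd.measurableEmbedding g

theorem fourier_schwartzToComplex (F : SchwartzMap (ℝ × ℝ) ℂ) (w : ℂ) :
    FourierTransform.fourier (schwartzToComplex F) w = FT F (w.re, w.im) := by
  rw [SchwartzMap.fourier_coe, Real.fourier_eq', FT, ← integral_comp_equivRealProd]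
  refine integral_congr_ae (Eventually.of_forall fun z => ?_)
  simp [schwartzToComplex, Complex.inner, mul_comm]

theorem fourierInv_schwartzToComplex (F : SchwartzMap (ℝ × ℝ) ℂ) (w : ℂ) :
    FourierTransformInv.fourierInv (schwartzToComplex F) w = FTinv F (w.re, w.im) := by
  rw [SchwartzMap.fourierInv_coe, Real.fourierInv_eq', FTinv, ← integral_comp_equivRealProd]
  refine integral_congr_ae (Eventually.of_forall fun z => ?_)
  simp [schwartzToComplex, Complex.inner, mul_comm]

theorem integral_norm_sq_schwartzToComplex (F : SchwartzMap (ℝ × ℝ) ℂ) :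
    ∫ z, ‖schwartzToComplex F z‖ ^ 2 = ∫ x, ‖F x‖ ^ 2 := by
  rw [← integral_comp_equivRealProd]; rfl

theorem integral_norm_sq_schwartzOfComplex (F : SchwartzMap ℂ ℂ) :
    ∫ x, ‖schwartzOfComplex F x‖ ^ 2 = ∫ z, ‖F z‖ ^ 2 := by
  rw [← integral_comp_equivRealProd]; rfl

theorem exists_schwartz_FT (F : SchwartzMap (ℝ × ℝ) ℂ) :
    ∃ G : SchwartzMap (ℝ × ℝ) ℂ, ⇑G = FT F ∧ ∫ x, ‖G x‖ ^ 2 = ∫ x, ‖F x‖ ^ 2 := by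
  refine ⟨schwartzOfComplex (FourierTransform.fourier (schwartzToComplex F)), ?_, ?_⟩
  · ext x
    exact fourier_schwartzToComplex F ⟨x.1, x.2⟩
  · rw [integral_norm_sq_schwartzOfComplex, SchwartzMap.integral_norm_sq_fourier,
      integral_norm_sq_schwartzToComplex]

theorem exists_schwartz_FTinv (F : SchwartzMap (ℝ × ℝ) ℂ) :
    ∃ G : SchwartzMap (ℝ × ℝ) ℂ, ⇑G = FTinv F ∧ ∫ x, ‖G x‖ ^ 2 = ∫ x, ‖F x‖ ^ 2 := by
  refine ⟨schwartzOfComplex (FourierTransformInv.fourierInv (schwartzToComplex F)), ?_, ?_⟩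
  · ext x
    exact fourierInv_schwartzToComplex F ⟨x.1, x.2⟩
  · rw [integral_norm_sq_schwartzOfComplex, ← SchwartzMap.integral_norm_sq_fourier,
      FourierTransform.fourier_fourierInv_eq, integral_norm_sq_schwartzToComplex]

theorem map_volume_diag {α β : ℝ} (hα : α ≠ 0) (hβ : β ≠ 0) :
    Measure.map (fun x : ℝ × ℝ => (α * x.1, β * x.2)) volume
      = ENNReal.ofReal |(α * β)⁻¹| • (volume : Measure (ℝ × ℝ)) := by
  have h := Measure.map_prod_map (volume : Measure ℝ) (volume : Measure ℝ)
    (measurable_const_mul α) (measurable_const_mul β)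
  change _ = Measure.map (fun x : ℝ × ℝ => (α * x.1, β * x.2)) _ at h
  rw [Measure.volume_eq_prod, ← h, Real.map_volume_mul_left hα, Real.map_volume_mul_left hβ,
    Measure.prod_smul_left, Measure.prod_smul_right, smul_smul, ← ENNReal.ofReal_mul (abs_nonneg _),
    mul_inv, abs_mul]

/-- The diagonal dilation of `ℝ × ℝ` as a homeomorphism. -/
def diagHomeo (α β : ℝ) (hα : α ≠ 0) (hβ : β ≠ 0) : (ℝ × ℝ) ≃ₜ (ℝ × ℝ) :=
  (Homeomorph.mulLeft₀ α hα).prodCongr (Homeomorph.mulLeft₀ β hβ)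

theorem lintegral_comp_diag {α β : ℝ} (hα : α ≠ 0) (hβ : β ≠ 0) (g : ℝ × ℝ → ℝ≥0∞) :
    ∫⁻ x : ℝ × ℝ, g (α * x.1, β * x.2) = ENNReal.ofReal |(α * β)⁻¹| * ∫⁻ x, g x := by
  have h := lintegral_map_equiv (μ := volume) g (diagHomeo α β hα hβ).toMeasurableEquiv
  have h2 := map_volume_diag hα hβ
  change Measure.map (diagHomeo α β hα hβ).toMeasurableEquiv volume = _ at h2
  rw [h2, lintegral_smul_measure] at h
  exact h.symm

theorem integral_comp_diag {α β : ℝ} (hα : α ≠ 0) (hβ : β ≠ 0) (g : ℝ × ℝ → ℂ) :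
    ∫ x : ℝ × ℝ, g (α * x.1, β * x.2) = |(α * β)⁻¹| • ∫ x, g x := by
  have h := integral_map_equiv (μ := volume) (diagHomeo α β hα hβ).toMeasurableEquiv g
  have h2 := map_volume_diag hα hβ
  change Measure.map (diagHomeo α β hα hβ).toMeasurableEquiv volume = _ at h2
  rw [h2, integral_smul_measure, ENNReal.toReal_ofReal (abs_nonneg _)] at h
  exact h.symm

/-- The `L¹` norm of an inverse Fourier transform is invariant under diagonal dilations. -/
theorem lintegral_FTinv_comp_diag {α β : ℝ} (hα : α ≠ 0) (hβ : β ≠ 0) (a : ℝ × ℝ → ℂ) :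
    ∫⁻ x, ‖FTinv (fun ξ => a (α * ξ.1, β * ξ.2)) x‖ₑ = ∫⁻ x, ‖FTinv a x‖ₑ := by
  have key : ∀ x : ℝ × ℝ, FTinv (fun ξ => a (α * ξ.1, β * ξ.2)) x
      = |(α * β)⁻¹| • FTinv a (α⁻¹ * x.1, β⁻¹ * x.2) := by
    intro x
    rw [FTinv, FTinv, ← integral_comp_diag hα hβ]
    refine integral_congr_ae (Eventually.of_forall fun ξ => ?_)
    have : α⁻¹ * x.1 * (α * ξ.1) + β⁻¹ * x.2 * (β * ξ.2) = x.1 * ξ.1 + x.2 * ξ.2 := by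
      field_simp
    simp only [this]
  simp_rw [key, enorm_smul]
  rw [lintegral_const_mul' _ _ enorm_ne_top,
    lintegral_comp_diag (inv_ne_zero hα) (inv_ne_zero hβ) (fun x => ‖FTinv a x‖ₑ), ← mul_assoc,
    Real.enorm_eq_ofReal_abs, ← ENNReal.ofReal_mul (abs_nonneg _), abs_abs, ← abs_mul]
  have : (α * β)⁻¹ * (α⁻¹ * β⁻¹)⁻¹ = 1 := by field_simp
  rw [this]; simp

/-- The multiplier operator with symbol `a · ν̂`, for a finite measure `ν` given as the image of
`w dμ` under `P`, is bounded in `L¹` by `‖w‖₁ ‖FTinv a‖₁`. -/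
theorem lintegral_FTinv_mul_le {S : Type*} [MeasurableSpace S] (μ : Measure S) [SFinite μ]
    {w : S → ℂ} (hw : Integrable w μ) {P : S → ℝ × ℝ} (hP : Measurable P)
    {a : ℝ × ℝ → ℂ} (ha : Integrable a) (hk : Continuous (FTinv a)) :
    ∫⁻ x, ‖FTinv (fun ξ => a ξ * ∫ s, Complex.exp ((((-(2 * Real.pi *
      ((P s).1 * ξ.1 + (P s).2 * ξ.2))) : ℝ) : ℂ) * Complex.I) * w s ∂μ) x‖ₑ
      ≤ (∫⁻ s, ‖w s‖ₑ ∂μ) * ∫⁻ x, ‖FTinv a x‖ₑ := by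
  have key : ∀ x : ℝ × ℝ, FTinv (fun ξ => a ξ * ∫ s, Complex.exp ((((-(2 * Real.pi *
      ((P s).1 * ξ.1 + (P s).2 * ξ.2))) : ℝ) : ℂ) * Complex.I) * w s ∂μ) x
      = ∫ s, w s * FTinv a (x - P s) ∂μ := by
    intro x
    simp only [FTinv]
    simp_rw [← mul_assoc, ← integral_const_mul]
    rw [integral_integral_swap]
    · refine integral_congr_ae (Eventually.of_forall fun s => integral_congr_ae
        (Eventually.of_forall fun ξ => ?_))
      simp only [Prod.fst_sub, Prod.snd_sub]
      have : Complex.exp (((2 * Real.pi * ((x.1 - (P s).1) * ξ.1 + (x.2 - (P s).2) * ξ.2) : ℝ) : ℂ)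
          * Complex.I) = Complex.exp (((2 * Real.pi * (x.1 * ξ.1 + x.2 * ξ.2) : ℝ) : ℂ) * Complex.I)
          * Complex.exp ((((-(2 * Real.pi * ((P s).1 * ξ.1 + (P s).2 * ξ.2))) : ℝ) : ℂ)
            * Complex.I) := by
        rw [← Complex.exp_add, ← add_mul, ← Complex.ofReal_add]
        ring_nf
      rw [this]; ring
    · have h1 : Integrable (fun z : (ℝ × ℝ) × S => a z.1 * w z.2) (volume.prod μ) := ha.mul_prod hw
      have h2 := h1.bdd_mul (c := 1) (f := fun z : (ℝ × ℝ) × S =>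
        Complex.exp (((2 * Real.pi * (x.1 * z.1.1 + x.2 * z.1.2) : ℝ) : ℂ) * Complex.I) *
        Complex.exp ((((-(2 * Real.pi * ((P z.2).1 * z.1.1 + (P z.2).2 * z.1.2))) : ℝ) : ℂ)
          * Complex.I)) (by
          have : Measurable fun z : (ℝ × ℝ) × S => P z.2 := hP.comp measurable_snd
          refine Measurable.aestronglyMeasurable ?_
          have h3 := this.fst
          have h4 := this.snd
          fun_prop) (Eventually.of_forall fun z => by
          rw [norm_mul, Complex.norm_exp_ofReal_mul_I, Complex.norm_exp_ofReal_mul_I, one_mul])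
      refine h2.congr (Eventually.of_forall fun z => ?_)
      simp only [Function.uncurry]
      ring
  simp_rw [key]
  calc ∫⁻ x, ‖∫ s, w s * FTinv a (x - P s) ∂μ‖ₑ
      ≤ ∫⁻ x, ∫⁻ s, ‖w s‖ₑ * ‖FTinv a (x - P s)‖ₑ ∂μ := by
        refine lintegral_mono fun x => (enorm_integral_le_lintegral_enorm _).trans ?_
        simp_rw [enorm_mul]; rfl
    _ = ∫⁻ s, (∫⁻ x, ‖w s‖ₑ * ‖FTinv a (x - P s)‖ₑ) ∂μ := by
        refine lintegral_lintegral_swap ?_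
        have h1 : AEMeasurable (fun z : (ℝ × ℝ) × S => ‖w z.2‖ₑ) (volume.prod μ) :=
          hw.1.enorm.comp_quasiMeasurePreserving Measure.quasiMeasurePreserving_snd
        have h2 : Measurable fun z : (ℝ × ℝ) × S => z.1 - P z.2 :=
          measurable_fst.sub (hP.comp measurable_snd)
        exact h1.mul (hk.measurable.comp h2).enorm.aemeasurable
    _ = _ := by
        rw [← lintegral_mul_const'' _ hw.1.enorm]
        refine lintegral_congr fun s => ?_
        rw [lintegral_const_mul' _ _ enorm_ne_top,
          lintegral_sub_right_eq_self (fun x => ‖FTinv a x‖ₑ) (P s)]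

theorem lintegral_min_mul_rpow {s κ y : ℝ} (hs0 : 0 < s) (hs1 : s < 1) (hκ : 0 < κ) (hy : 0 ≤ y) :
    ∫⁻ t in Ioi (0 : ℝ), ENNReal.ofReal (min y (κ * t * y ^ 2) * t ^ (-1 - s))
      = ENNReal.ofReal ((1 / (1 - s) + 1 / s) * (κ ^ s * y ^ (1 + s))) := by
  rcases hy.eq_or_lt with rfl | hy
  · simp [Real.zero_rpow (by linarith : 1 + s ≠ 0)]
  set a : ℝ := (κ * y)⁻¹ with ha
  have ha0 : 0 < a := by positivity
  have hsplit : Ioi (0 : ℝ) = Ioc 0 a ∪ Ioi a := (Ioc_union_Ioi_eq_Ioi ha0.le).symm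
  have e1 : ∫⁻ t in Ioc 0 a, ENNReal.ofReal (min y (κ * t * y ^ 2) * t ^ (-1 - s))
      = ENNReal.ofReal (κ ^ s * y ^ (1 + s) / (1 - s)) := by
    have h1 : ∫⁻ t in Ioc 0 a, ENNReal.ofReal (min y (κ * t * y ^ 2) * t ^ (-1 - s))
        = ∫⁻ t in Ioc 0 a, ENNReal.ofReal (κ * y ^ 2 * t ^ (-s)) := by
      refine setLIntegral_congr_fun measurableSet_Ioc fun t ht => ?_
      have h2 : κ * t * y ^ 2 ≤ y := by
        have : κ * y * t ≤ 1 := by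
          calc κ * y * t ≤ κ * y * a := by gcongr; exact ht.2
            _ = 1 := mul_inv_cancel₀ (by positivity)
        nlinarith
      have h3 : t ^ (-s) = t * t ^ (-1 - s) := by
        rw [← Real.rpow_one_add' ht.1.le (by linarith)]; ring_nf
      rw [min_eq_right h2, h3]; ring_nf
    have hi : IntervalIntegrable (fun t : ℝ => κ * y ^ 2 * t ^ (-s)) volume 0 a :=
      (intervalIntegral.intervalIntegrable_rpow' (by linarith)).const_mul _
    rw [h1, ← ofReal_integral_eq_lintegral_ofReal
      ((intervalIntegrable_iff_integrableOn_Ioc_of_le ha0.le).mp hi)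
      ((ae_restrict_mem measurableSet_Ioc).mono fun t ht => by
        have := ht.1
        positivity),
      ← intervalIntegral.integral_of_le ha0.le, intervalIntegral.integral_const_mul,
      integral_rpow (Or.inl (by linarith)), Real.zero_rpow (by linarith), sub_zero, ha,
      Real.inv_rpow (by positivity), Real.mul_rpow hκ.le hy.le, Real.rpow_add hκ,
      Real.rpow_add hy, Real.rpow_add hy, Real.rpow_neg hκ.le, Real.rpow_neg hy.le]
    congr 1
    have h4 : 1 - s ≠ 0 := by linarith
    have h5 : -s + 1 ≠ 0 := by linarith
    have := (Real.rpow_pos_of_pos hκ s).ne'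
    have := (Real.rpow_pos_of_pos hy s).ne'
    simp only [Real.rpow_one]
    field_simp
    ring
  have e2 : ∫⁻ t in Ioi a, ENNReal.ofReal (min y (κ * t * y ^ 2) * t ^ (-1 - s))
      = ENNReal.ofReal (κ ^ s * y ^ (1 + s) / s) := by
    have h1 : ∫⁻ t in Ioi a, ENNReal.ofReal (min y (κ * t * y ^ 2) * t ^ (-1 - s))
        = ∫⁻ t in Ioi a, ENNReal.ofReal (y * t ^ (-1 - s)) := by
      refine setLIntegral_congr_fun measurableSet_Ioi fun t ht => ?_
      have h2 : y ≤ κ * t * y ^ 2 := by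
        have : 1 ≤ κ * y * t := by
          calc 1 = κ * y * a := (mul_inv_cancel₀ (by positivity)).symm
            _ ≤ κ * y * t := by gcongr; exact (mem_Ioi.mp ht).le
        nlinarith
      simp only [min_eq_left h2]
    rw [h1, ← ofReal_integral_eq_lintegral_ofReal
      ((integrableOn_Ioi_rpow_of_lt (by linarith) ha0).const_mul y)
      ((ae_restrict_mem measurableSet_Ioi).mono fun t ht => by
        have := ha0.trans (mem_Ioi.mp ht)
        positivity),
      integral_const_mul, integral_Ioi_rpow_of_lt (by linarith) ha0, ha,
      Real.inv_rpow (by positivity), Real.mul_rpow hκ.le hy.le,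
      show -1 - s + 1 = -s by ring, Real.rpow_neg hκ.le, Real.rpow_neg hy.le, Real.rpow_add hy]
    congr 1
    have := (Real.rpow_pos_of_pos hκ s).ne'
    have := (Real.rpow_pos_of_pos hy s).ne'
    simp only [Real.rpow_one]
    field_simp
  have h6 : 0 < 1 - s := by linarith
  rw [hsplit, lintegral_union measurableSet_Ioi (Set.Ioc_disjoint_Ioi le_rfl), e1, e2,
    ← ENNReal.ofReal_add (by positivity) (by positivity)]
  congr 1
  field_simp

/-- Real interpolation by the functional `∫ min(g, t g²)`, with equality of constants. -/
theorem lintegral_rpow_le_of_min_le {α : Type*} [MeasurableSpace α] {μ : Measure α} [SFinite μ]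
    {g h : α → ℝ} (hg : Measurable g) (hh : Measurable h) (hg0 : ∀ x, 0 ≤ g x)
    (hh0 : ∀ x, 0 ≤ h x) {s κ : ℝ} (hs0 : 0 < s) (hs1 : s < 1) (hκ : 0 < κ) {M : ℝ≥0∞} (hM : M ≠ ∞)
    (H : ∀ t : ℝ, 0 < t → ∫⁻ x, ENNReal.ofReal (min (g x) (t * g x ^ 2)) ∂μ
      ≤ M * ∫⁻ x, ENNReal.ofReal (min (h x) (κ * t * h x ^ 2)) ∂μ) :
    ∫⁻ x, ENNReal.ofReal (g x ^ (1 + s)) ∂μ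
      ≤ M * ENNReal.ofReal (κ ^ s) * ∫⁻ x, ENNReal.ofReal (h x ^ (1 + s)) ∂μ := by
  have key : ∀ (k : α → ℝ) (_ : Measurable k) (_ : ∀ x, 0 ≤ k x) (θ : ℝ) (_ : 0 < θ),
      ∫⁻ t in Ioi (0 : ℝ), ENNReal.ofReal (t ^ (-1 - s)) *
        ∫⁻ x, ENNReal.ofReal (min (k x) (θ * t * k x ^ 2)) ∂μ
      = ENNReal.ofReal (1 / (1 - s) + 1 / s) * (ENNReal.ofReal (θ ^ s) *
        ∫⁻ x, ENNReal.ofReal (k x ^ (1 + s)) ∂μ) := by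
    intro k hk hk0 θ hθ
    have h6 : 0 < 1 - s := by linarith
    simp_rw [← lintegral_const_mul' _ _ ENNReal.ofReal_ne_top]
    rw [lintegral_lintegral_swap]
    · refine lintegral_congr fun x => ?_
      rw [← ENNReal.ofReal_mul (by positivity), ← ENNReal.ofReal_mul (by positivity),
        ← lintegral_min_mul_rpow hs0 hs1 hθ (hk0 x)]
      refine setLIntegral_congr_fun measurableSet_Ioi fun t ht => ?_
      have ht : 0 < t := ht
      rw [← ENNReal.ofReal_mul (by positivity), mul_comm]
    · refine Measurable.aemeasurable ?_
      have : Measurable fun z : ℝ × α => k z.2 := hk.comp measurable_snd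
      simp only [Function.uncurry_def]
      fun_prop
  have h6 : 0 < 1 - s := by linarith
  have hc : ENNReal.ofReal (1 / (1 - s) + 1 / s) ≠ 0 := by
    rw [Ne, ENNReal.ofReal_eq_zero, not_le]; positivity
  rw [← ENNReal.mul_le_mul_iff_right hc ENNReal.ofReal_ne_top]
  have k1 := key g hg hg0 1 one_pos
  have k2 := key h hh hh0 κ hκ
  rw [Real.one_rpow, ENNReal.ofReal_one, one_mul] at k1
  calc _ = _ := k1.symm
    _ ≤ ∫⁻ t in Ioi (0 : ℝ), M * (ENNReal.ofReal (t ^ (-1 - s)) *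
        ∫⁻ x, ENNReal.ofReal (min (h x) (κ * t * h x ^ 2)) ∂μ) := by
        refine setLIntegral_mono' measurableSet_Ioi fun t ht => ?_
        rw [mul_left_comm]
        gcongr
        simpa only [one_mul] using H t ht
    _ = _ := by
        rw [lintegral_const_mul' _ _ hM, k2]
        ring

/-- Splitting a Schwartz function into a large and a small part, both Schwartz. -/
theorem exists_schwartz_split (f : SchwartzMap (ℝ × ℝ) ℝ) {lam : ℝ} (hlam : 0 < lam) :
    ∃ f₀ f₁ : SchwartzMap (ℝ × ℝ) ℝ, f = f₀ + f₁ ∧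
      (∀ x, |f₀ x| ≤ |f x|) ∧ (∀ x, |f x| < lam → f₀ x = 0) ∧
      (∀ x, |f₁ x| ≤ |f x|) ∧ (∀ x, 2 * lam < |f x| → f₁ x = 0) := by
  let κ : ContDiffBump (0 : ℝ) := ⟨1, 2, one_pos, one_lt_two⟩
  have hz : ∀ x, |f x| < lam → 1 - κ (f x / lam) = 0 := by
    intro x hx
    rw [sub_eq_zero, κ.one_of_mem_closedBall]
    simp only [Metric.mem_closedBall, dist_zero_right, Real.norm_eq_abs, abs_div, abs_of_pos hlam]
    exact (div_le_one hlam).mpr hx.le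
  have hsm : ContDiff ℝ (⊤ : ℕ∞) fun x => f x * (1 - κ (f x / lam)) :=
    (f.smooth _).mul (contDiff_const.sub (κ.contDiff.comp ((f.smooth _).div_const lam)))
  have hcs : HasCompactSupport fun x => f x * (1 - κ (f x / lam)) := by
    rw [hasCompactSupport_iff_eventuallyEq, coclosedCompact_eq_cocompact]
    have h1 : Tendsto f (cocompact (ℝ × ℝ)) (𝓝 0) := zero_at_infty f
    filter_upwards [h1 (Metric.ball_mem_nhds 0 hlam)] with x hx
    simp only [mem_preimage, Metric.mem_ball, dist_zero_right, Real.norm_eq_abs] at hx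
    simp [hz x hx]
  have h01 : ∀ v, 0 ≤ κ v ∧ κ v ≤ 1 := fun v => ⟨κ.nonneg, κ.le_one⟩
  have hf1 : ∀ x, (f - hcs.toSchwartzMap hsm) x = f x * κ (f x / lam) := by
    intro x; simp; ring
  refine ⟨hcs.toSchwartzMap hsm, f - hcs.toSchwartzMap hsm, by simp, ?_, ?_, ?_, ?_⟩
  · intro x
    simp only [HasCompactSupport.toSchwartzMap_toFun, abs_mul]
    refine mul_le_of_le_one_right (abs_nonneg _) ?_
    rw [abs_le]
    constructor <;> linarith [h01 (f x / lam)]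
  · intro x hx
    simp [hz x hx]
  · intro x
    rw [hf1, abs_mul]
    refine mul_le_of_le_one_right (abs_nonneg _) ?_
    rw [abs_le]
    constructor <;> linarith [h01 (f x / lam)]
  · intro x hx
    rw [hf1, κ.zero_of_le_dist, mul_zero]
    simp only [dist_zero_right, Real.norm_eq_abs, abs_div, abs_of_pos hlam]
    exact (le_div_iff₀ hlam).mpr hx.le

/-- Interpolation between `L¹` and `L²` for additive operators on Schwartz functions. -/
theorem lintegral_rpow_le_of_L1_L2 {T : (ℝ × ℝ → ℝ) → ℝ × ℝ → ℂ} {C δ : ℝ} (hC : 1 ≤ C)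
    (hδ : 0 < δ) (hadd : ∀ f g : SchwartzMap (ℝ × ℝ) ℝ, T ⇑(f + g) = T f + T g)
    (hmeas : ∀ f : SchwartzMap (ℝ × ℝ) ℝ, Measurable (T f))
    (h1 : ∀ f : SchwartzMap (ℝ × ℝ) ℝ, ∫⁻ x, ‖T f x‖ₑ ≤ ENNReal.ofReal C * ∫⁻ x, ‖f x‖ₑ)
    (h2 : ∀ f : SchwartzMap (ℝ × ℝ) ℝ,
      ∫⁻ x, ‖T f x‖ₑ ^ 2 ≤ ENNReal.ofReal (C * δ) * ∫⁻ x, ‖f x‖ₑ ^ 2)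
    {s : ℝ} (hs0 : 0 ≤ s) (hs1 : s ≤ 1) (f : SchwartzMap (ℝ × ℝ) ℝ) :
    ∫⁻ x, ‖T f x‖ₑ ^ (1 + s)
      ≤ ENNReal.ofReal (10 * C * δ ^ s) * ∫⁻ x, ‖f x‖ₑ ^ (1 + s) := by
  rcases hs0.eq_or_lt with rfl | hs0
  · simp only [add_zero, ENNReal.rpow_one, Real.rpow_zero, mul_one]
    refine (h1 f).trans ?_
    gcongr
    linarith
  rcases hs1.eq_or_lt with rfl | hs1
  · have h3 := h2 f
    simp only [show (1 : ℝ) + 1 = (2 : ℕ) by norm_num, ENNReal.rpow_natCast, Real.rpow_one]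
    refine (h2 f).trans ?_
    gcongr
    linarith
  have hcv : ∀ {E : Type} [NormedAddCommGroup E] (z : E), ‖z‖ₑ ^ (1 + s)
      = ENNReal.ofReal (‖z‖ ^ (1 + s)) := by
    intro E _ z
    rw [← ofReal_norm, ENNReal.ofReal_rpow_of_nonneg (norm_nonneg _) (by linarith)]
  have hM : ENNReal.ofReal (10 * C * δ ^ s) = ENNReal.ofReal (10 * C) * ENNReal.ofReal (δ ^ s) :=
    ENNReal.ofReal_mul (by linarith)
  simp_rw [hcv]
  rw [hM]
  refine lintegral_rpow_le_of_min_le (hmeas f).norm f.continuous.measurable.norm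
    (fun x => norm_nonneg _) (fun x => norm_nonneg _) hs0 hs1 hδ ENNReal.ofReal_ne_top ?_
  intro t ht
  obtain ⟨f₀, f₁, hf, a₀, b₀, a₁, b₁⟩ := exists_schwartz_split f (lam := (δ * t)⁻¹) (by positivity)
  have hT : ∀ x, ‖T f x‖ ≤ ‖T f₀ x‖ + ‖T f₁ x‖ := by
    intro x
    rw [hf, hadd]
    exact norm_add_le _ _
  have hmin : ∀ x, ENNReal.ofReal (min ‖T f x‖ (t * ‖T f x‖ ^ 2))
      ≤ 2 * ‖T f₀ x‖ₑ + ENNReal.ofReal (4 * t) * ‖T f₁ x‖ₑ ^ 2 := by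
    intro x
    rw [← ofReal_norm, ← ofReal_norm, ← ENNReal.ofReal_pow (norm_nonneg _),
      ← ENNReal.ofReal_mul (by positivity), ← ENNReal.ofReal_ofNat,
      ← ENNReal.ofReal_mul (by positivity), ← ENNReal.ofReal_add (by positivity) (by positivity)]
    refine ENNReal.ofReal_le_ofReal ?_
    have n0 := norm_nonneg (T f₀ x)
    have n1 := norm_nonneg (T f₁ x)
    rcases le_total ‖T f₁ x‖ ‖T f₀ x‖ with h | h
    · refine (min_le_left _ _).trans ?_
      have : 0 ≤ 4 * t * ‖T f₁ x‖ ^ 2 := by positivity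
      linarith [hT x]
    · refine (min_le_right _ _).trans ?_
      have : ‖T f x‖ ^ 2 ≤ (2 * ‖T f₁ x‖) ^ 2 := by
        gcongr
        linarith [hT x]
      nlinarith
  have hsmall : ∀ x, ‖f₀ x‖ₑ ≤ ENNReal.ofReal (min ‖f x‖ (δ * t * ‖f x‖ ^ 2)) := by
    intro x
    rw [← ofReal_norm]
    refine ENNReal.ofReal_le_ofReal ?_
    simp only [Real.norm_eq_abs]
    by_cases h : |f x| < (δ * t)⁻¹
    · rw [b₀ x h, abs_zero]; positivity
    · refine le_min (a₀ x) ((a₀ x).trans ?_)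
      rw [not_lt, inv_le_iff_one_le_mul₀ (by positivity)] at h
      nlinarith [abs_nonneg (f x)]
  have hlarge : ∀ x, ENNReal.ofReal (δ * t) * ‖f₁ x‖ₑ ^ 2
      ≤ 2 * ENNReal.ofReal (min ‖f x‖ (δ * t * ‖f x‖ ^ 2)) := by
    intro x
    rw [← ofReal_norm, ← ENNReal.ofReal_pow (norm_nonneg _),
      ← ENNReal.ofReal_mul (by positivity), ← ENNReal.ofReal_ofNat,
      ← ENNReal.ofReal_mul (by positivity)]
    refine ENNReal.ofReal_le_ofReal ?_
    simp only [Real.norm_eq_abs]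
    by_cases h : 2 * (δ * t)⁻¹ < |f x|
    · have : 0 ≤ min |f x| (δ * t * |f x| ^ 2) := by positivity
      rw [b₁ x h, abs_zero]
      linarith
    · have h3 : δ * t * |f₁ x| ^ 2 ≤ δ * t * |f x| ^ 2 := by
        exact mul_le_mul_of_nonneg_left (pow_le_pow_left₀ (abs_nonneg _) (a₁ x) 2) (by positivity)
      have h4 : δ * t * |f x| ≤ 2 := by
        rw [not_lt] at h
        calc δ * t * |f x| ≤ δ * t * (2 * (δ * t)⁻¹) := by gcongr
          _ = 2 := by field_simp
      rw [mul_min_of_nonneg _ _ zero_le_two]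
      refine le_min (by nlinarith [abs_nonneg (f x)]) ?_
      have : 0 ≤ δ * t * |f x| ^ 2 := by positivity
      linarith
  set J := ∫⁻ x, ENNReal.ofReal (min ‖f x‖ (δ * t * ‖f x‖ ^ 2)) with hJ
  have i1 : ∫⁻ x, ‖T f₀ x‖ₑ ≤ ENNReal.ofReal C * J :=
    (h1 f₀).trans (mul_le_mul_right (lintegral_mono hsmall) _)
  have i2 : ENNReal.ofReal t * ∫⁻ x, ‖T f₁ x‖ₑ ^ 2 ≤ ENNReal.ofReal (2 * C) * J := by
    calc ENNReal.ofReal t * ∫⁻ x, ‖T f₁ x‖ₑ ^ 2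
        ≤ ENNReal.ofReal t * (ENNReal.ofReal (C * δ) * ∫⁻ x, ‖f₁ x‖ₑ ^ 2) := by
          gcongr; exact h2 f₁
      _ = ENNReal.ofReal C * ∫⁻ x, ENNReal.ofReal (δ * t) * ‖f₁ x‖ₑ ^ 2 := by
          rw [lintegral_const_mul' _ _ ENNReal.ofReal_ne_top, ENNReal.ofReal_mul (by linarith),
            ENNReal.ofReal_mul hδ.le]
          ring
      _ ≤ ENNReal.ofReal C * ∫⁻ x, 2 * ENNReal.ofReal (min ‖f x‖ (δ * t * ‖f x‖ ^ 2)) := by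
          exact mul_le_mul_right (lintegral_mono hlarge) _
      _ = _ := by
          rw [lintegral_const_mul' _ _ ENNReal.ofNat_ne_top, ENNReal.ofReal_mul zero_le_two,
            ENNReal.ofReal_ofNat]
          ring
  calc _ ≤ ∫⁻ x, (2 * ‖T f₀ x‖ₑ + ENNReal.ofReal (4 * t) * ‖T f₁ x‖ₑ ^ 2) := lintegral_mono hmin
    _ = 2 * (∫⁻ x, ‖T f₀ x‖ₑ) + 4 * (ENNReal.ofReal t * ∫⁻ x, ‖T f₁ x‖ₑ ^ 2) := by
        rw [lintegral_add_left ((hmeas f₀).enorm.const_mul 2),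
          lintegral_const_mul' _ _ ENNReal.ofNat_ne_top,
          lintegral_const_mul' _ _ ENNReal.ofReal_ne_top, ENNReal.ofReal_mul (by norm_num),
          ENNReal.ofReal_ofNat, mul_assoc]
    _ ≤ 2 * (ENNReal.ofReal C * J) + 4 * (ENNReal.ofReal (2 * C) * J) := by gcongr
    _ = _ := by
        rw [ENNReal.ofReal_mul zero_le_two, ENNReal.ofReal_mul (by norm_num : (0 : ℝ) ≤ 10),
          ENNReal.ofReal_ofNat, ENNReal.ofReal_ofNat]
        ring

/-- Van der Corput estimate with second derivative of constant sign comparable to `lam`,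
for a smooth amplitude supported in the interval. -/
theorem van_der_corput {φ φ' φ'' : ℝ → ℝ} {χ χ' : ℝ → ℝ} {c d K₀ K₁ lam x y : ℝ}
    (hxy : x ≤ y) (hlam : 0 < lam) (hc : 0 < c)
    (hφ : ∀ t ∈ Icc x y, HasDerivAt φ (φ' t) t)
    (hφ' : ∀ t ∈ Icc x y, HasDerivAt φ' (φ'' t) t)
    (hφ'' : ContinuousOn φ'' (Icc x y))
    (hlow : ∀ t ∈ Icc x y, c * lam ≤ φ'' t) (hup : ∀ t ∈ Icc x y, φ'' t ≤ d * lam)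
    (hχ : ∀ t ∈ Icc x y, HasDerivAt χ (χ' t) t) (hχ' : ContinuousOn χ' (Icc x y))
    (hχx : χ x = 0) (hχy : χ y = 0)
    (hK₀ : ∀ t ∈ Icc x y, |χ t| ≤ K₀) (hK₁ : ∀ t ∈ Icc x y, |χ' t| ≤ K₁) :
    ‖∫ t in x..y, Complex.exp (((φ t : ℝ) : ℂ) * Complex.I) * ((χ t : ℝ) : ℂ)‖
      ≤ ((1 + d) * K₀ * (Real.pi / c) + K₁ * (y - x)) / Real.sqrt lam := by
  set r := Real.sqrt lam with hr
  have hr0 : 0 < r := Real.sqrt_pos.mpr hlam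
  have hr2 : r ^ 2 = lam := Real.sq_sqrt hlam.le
  have hu : uIcc x y = Icc x y := uIcc_of_le hxy
  have hx : x ∈ Icc x y := left_mem_Icc.mpr hxy
  have hy : y ∈ Icc x y := right_mem_Icc.mpr hxy
  have hK₀0 : 0 ≤ K₀ := (abs_nonneg _).trans (hK₀ x hx)
  have hK₁0 : 0 ≤ K₁ := (abs_nonneg _).trans (hK₁ x hx)
  have hd : 0 ≤ d := by
    have := (mul_pos hc hlam).le.trans ((hlow x hx).trans (hup x hx))
    exact nonneg_of_mul_nonneg_left this hlam
  have hq : ∀ t, 0 < lam + φ' t ^ 2 := fun t => by positivity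
  have cφ : ContinuousOn φ (Icc x y) := fun t ht => (hφ t ht).continuousAt.continuousWithinAt
  have cφ' : ContinuousOn φ' (Icc x y) := fun t ht => (hφ' t ht).continuousAt.continuousWithinAt
  have cχ : ContinuousOn χ (Icc x y) := fun t ht => (hχ t ht).continuousAt.continuousWithinAt
  have cq : ContinuousOn (fun t => lam + φ' t ^ 2) (Icc x y) := by fun_prop
  set w : ℝ → ℝ := fun t => φ' t * χ t / (lam + φ' t ^ 2) with hw
  set w' : ℝ → ℝ := fun t => ((φ'' t * χ t + φ' t * χ' t) * (lam + φ' t ^ 2)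
    - φ' t * χ t * (2 * φ' t * φ'' t)) / (lam + φ' t ^ 2) ^ 2 with hw'
  have dw : ∀ t ∈ Icc x y, HasDerivAt w (w' t) t := by
    intro t ht
    have h1 := ((hφ' t ht).mul (hχ t ht)).div (((hφ' t ht).pow 2).const_add lam) (hq t).ne'
    convert! h1 using 1
    simp [w']
  have cw' : ContinuousOn w' (Icc x y) :=
    ContinuousOn.div (by fun_prop) (by fun_prop) fun t _ => (pow_pos (hq t) 2).ne'
  set e : ℝ → ℂ := fun t => Complex.exp (((φ t : ℝ) : ℂ) * Complex.I) with he
  have ce : ContinuousOn e (Icc x y) := by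
    have : ContinuousOn (fun t => ((φ t : ℝ) : ℂ)) (Icc x y) :=
      Complex.continuous_ofReal.comp_continuousOn cφ
    fun_prop
  have de : ∀ t ∈ Icc x y, HasDerivAt (fun t => e t * ((w t : ℝ) : ℂ))
      (e t * (((φ' t : ℝ) : ℂ) * Complex.I) * ((w t : ℝ) : ℂ) + e t * ((w' t : ℝ) : ℂ)) t := by
    intro t ht
    exact (((hφ t ht).ofReal_comp.mul_const Complex.I).cexp).mul (dw t ht).ofReal_comp
  have oc : ∀ {g : ℝ → ℝ}, ContinuousOn g (Icc x y) →
      ContinuousOn (fun t => ((g t : ℝ) : ℂ)) (Icc x y) :=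
    fun h => Complex.continuous_ofReal.comp_continuousOn h
  have cw : ContinuousOn w (Icc x y) := fun t ht => (dw t ht).continuousAt.continuousWithinAt
  have cd : ContinuousOn (fun t => e t * (((φ' t : ℝ) : ℂ) * Complex.I) * ((w t : ℝ) : ℂ)
      + e t * ((w' t : ℝ) : ℂ)) (Icc x y) := by
    have h1 := oc cφ'
    have h2 := oc cw
    have h3 := oc cw'
    fun_prop
  have hzero : ∫ t in x..y, (e t * (((φ' t : ℝ) : ℂ) * Complex.I) * ((w t : ℝ) : ℂ)
      + e t * ((w' t : ℝ) : ℂ)) = 0 := by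
    rw [intervalIntegral.integral_eq_sub_of_hasDerivAt (fun t ht => de t (hu ▸ ht))
      ((hu.symm ▸ cd).intervalIntegrable)]
    simp [w, hχx, hχy]
  have hsplit : ∫ t in x..y, e t * ((χ t : ℝ) : ℂ)
      = ∫ t in x..y, (((lam * χ t / (lam + φ' t ^ 2) : ℝ) : ℂ) * e t
        + Complex.I * (e t * ((w' t : ℝ) : ℂ))) := by
    rw [← add_zero (∫ t in x..y, _), ← mul_zero Complex.I, ← hzero,
      ← intervalIntegral.integral_const_mul, ← intervalIntegral.integral_add]
    · refine intervalIntegral.integral_congr fun t ht => ?_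
      have h1 : ((lam : ℂ) + (φ' t : ℂ) ^ 2) ≠ 0 := by exact_mod_cast (hq t).ne'
      simp only [w]
      push_cast
      field_simp
      ring_nf
      simp only [Complex.I_sq]
      ring
    · exact (hu.symm ▸ ce.mul (oc cχ)).intervalIntegrable
    · exact (hu.symm ▸ continuousOn_const.mul cd).intervalIntegrable
  rw [hsplit]
  set G' : ℝ → ℝ := fun t => (1 + d) * K₀ / (c * r) * (1 / (1 + (φ' t / r) ^ 2) * (φ'' t / r))
    + K₁ / r with hG'
  have dG : ∀ t ∈ Icc x y, HasDerivAt
      (fun t => (1 + d) * K₀ / (c * r) * Real.arctan (φ' t / r) + K₁ / r * t) (G' t) t := by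
    intro t ht
    have h1 := ((hφ' t ht).div_const r).arctan.const_mul ((1 + d) * K₀ / (c * r))
    convert! h1.add ((hasDerivAt_id t).const_mul (K₁ / r)) using 1
    simp [G']
  have cG' : ContinuousOn G' (Icc x y) := by
    have h1 : ContinuousOn (fun t => 1 / (1 + (φ' t / r) ^ 2)) (Icc x y) :=
      ContinuousOn.div (by fun_prop) (by fun_prop) fun t _ => by positivity
    fun_prop
  have hle_int : ∫ t in x..y, G' t ≤ ((1 + d) * K₀ * (Real.pi / c) + K₁ * (y - x)) / r := by
    rw [intervalIntegral.integral_eq_sub_of_hasDerivAt (fun t ht => dG t (hu ▸ ht))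
      ((hu.symm ▸ cG').intervalIntegrable)]
    have h1 := Real.arctan_lt_pi_div_two (φ' y / r)
    have h2 := Real.neg_pi_div_two_lt_arctan (φ' x / r)
    have h3 : 0 ≤ (1 + d) * K₀ / (c * r) := by positivity
    have h4 : (1 + d) * K₀ / (c * r) * (Real.arctan (φ' y / r) - Real.arctan (φ' x / r))
        ≤ (1 + d) * K₀ / (c * r) * Real.pi := mul_le_mul_of_nonneg_left (by linarith) h3
    calc _ = (1 + d) * K₀ / (c * r) * (Real.arctan (φ' y / r) - Real.arctan (φ' x / r))
          + K₁ / r * (y - x) := by ring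
      _ ≤ (1 + d) * K₀ / (c * r) * Real.pi + K₁ / r * (y - x) := by linarith
      _ = _ := by field_simp
  refine (intervalIntegral.norm_integral_le_of_norm_le hxy (g := G') ?_
    ((hu.symm ▸ cG').intervalIntegrable)).trans hle_int
  refine Eventually.of_forall fun t ht => ?_
  have ht : t ∈ Icc x y := Ioc_subset_Icc_self ht
  have hnorm : ‖e t‖ = 1 := Complex.norm_exp_ofReal_mul_I _
  refine (norm_add_le _ _).trans ?_
  rw [norm_mul, norm_mul, norm_mul, hnorm, Complex.norm_I, Complex.norm_real, Complex.norm_real,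
    mul_one, one_mul, one_mul, Real.norm_eq_abs, Real.norm_eq_abs]
  set Q := lam + φ' t ^ 2 with hQ
  have hQ0 : 0 < Q := hq t
  have hφ0 : 0 ≤ φ'' t := (mul_pos hc hlam).le.trans (hlow t ht)
  have b1 : |lam * χ t / Q| ≤ lam / Q * K₀ := by
    rw [abs_div, abs_mul, abs_of_pos hlam, abs_of_pos hQ0, mul_div_right_comm]
    exact mul_le_mul_of_nonneg_left (hK₀ t ht) (by positivity)
  have b2 : |w' t| ≤ φ'' t / Q * K₀ + K₁ / r := by
    have h1 : w' t = φ'' t / Q * ((lam - φ' t ^ 2) / Q) * χ t + φ' t / Q * χ' t := by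
      simp only [w', ← hQ]
      field_simp
      rw [hQ]; ring
    have h2 : |(lam - φ' t ^ 2) / Q| ≤ 1 := by
      rw [abs_div, abs_of_pos hQ0, div_le_one hQ0, abs_le]
      constructor <;> nlinarith [sq_nonneg (φ' t)]
    have h3 : |φ' t / Q| ≤ 1 / r := by
      rw [abs_div, abs_of_pos hQ0, div_le_div_iff₀ hQ0 hr0, hQ, ← hr2, ← sq_abs (φ' t)]
      nlinarith [sq_nonneg (r - |φ' t|), sq_nonneg r, sq_nonneg (|φ' t|), abs_nonneg (φ' t)]
    rw [h1]
    refine (abs_add_le _ _).trans (add_le_add ?_ ?_)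
    · rw [abs_mul, abs_mul, abs_of_nonneg (div_nonneg hφ0 hQ0.le)]
      calc φ'' t / Q * |(lam - φ' t ^ 2) / Q| * |χ t| ≤ φ'' t / Q * 1 * K₀ := by
            gcongr
            exact hK₀ t ht
        _ = _ := by ring
    · rw [abs_mul]
      calc |φ' t / Q| * |χ' t| ≤ 1 / r * K₁ := by
            gcongr
            exact hK₁ t ht
        _ = _ := by ring
  have b3 : G' t = (1 + d) * K₀ / c * (φ'' t / Q) + K₁ / r := by
    simp only [G', hQ, ← hr2]
    field_simp
  have b4 : lam / Q ≤ φ'' t / Q / c := by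
    rw [div_div, div_le_div_iff₀ hQ0 (by positivity)]
    nlinarith [mul_le_mul_of_nonneg_right (hlow t ht) hQ0.le]
  have b5 : φ'' t / Q ≤ d * (φ'' t / Q / c) := by
    calc φ'' t / Q ≤ d * lam / Q := by gcongr; exact hup t ht
      _ = d * (lam / Q) := by ring
      _ ≤ _ := by gcongr
  rw [b3]
  calc |lam * χ t / Q| + |w' t| ≤ lam / Q * K₀ + (φ'' t / Q * K₀ + K₁ / r) := add_le_add b1 b2
    _ ≤ φ'' t / Q / c * K₀ + (d * (φ'' t / Q / c) * K₀ + K₁ / r) := by gcongr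
    _ = _ := by ring

theorem exists_norm_oscillatory_integral_le {b : ℝ} (hb : 1 < b) {χ : ℝ → ℝ}
    (hχ : ContDiff ℝ (⊤ : ℕ∞) χ) (hχs : ∀ t : ℝ, t ∉ Ioo (1 / 2 : ℝ) 2 → χ t = 0) :
    ∃ C : ℝ, 0 ≤ C ∧ ∀ p q : ℝ, q ≠ 0 →
      ‖∫ t in (1 / 2 : ℝ)..2, Complex.exp (((p * t + q * t ^ b : ℝ) : ℂ) * Complex.I)
        * ((χ t : ℝ) : ℂ)‖ ^ 2 ≤ C / |q| := by
  have hpos : ∀ t ∈ Icc (1 / 2 : ℝ) 2, 0 < t := fun t ht => lt_of_lt_of_le (by norm_num) ht.1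
  have hne : (Icc (1 / 2 : ℝ) 2).Nonempty := ⟨1, by norm_num, by norm_num⟩
  have hbb : 0 < b * (b - 1) := by nlinarith
  have hcont : ContinuousOn (fun t : ℝ => b * (b - 1) * t ^ (b - 2)) (Icc (1 / 2 : ℝ) 2) :=
    continuousOn_const.mul (continuousOn_id.rpow_const fun t ht => Or.inl (hpos t ht).ne')
  obtain ⟨t₀, ht₀, hmin⟩ := isCompact_Icc.exists_isMinOn hne hcont
  obtain ⟨t₁, -, hmax⟩ := isCompact_Icc.exists_isMaxOn hne hcont
  have hχ1 : ContDiff ℝ 1 χ := hχ.of_le (by exact_mod_cast le_top)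
  have cχ' : Continuous (deriv χ) := hχ1.continuous_deriv le_rfl
  obtain ⟨K₀, hK₀⟩ := isCompact_Icc.exists_bound_of_continuousOn
    (hχ.continuous.continuousOn (s := Icc (1 / 2 : ℝ) 2))
  obtain ⟨K₁, hK₁⟩ := isCompact_Icc.exists_bound_of_continuousOn
    (cχ'.continuousOn (s := Icc (1 / 2 : ℝ) 2))
  set c := b * (b - 1) * t₀ ^ (b - 2) with hc
  set d := b * (b - 1) * t₁ ^ (b - 2) with hd
  have hc0 : 0 < c := mul_pos hbb (Real.rpow_pos_of_pos (hpos _ ht₀) _)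
  set M := (1 + d) * K₀ * (Real.pi / c) + K₁ * (2 - 1 / 2) with hM
  have key : ∀ p q : ℝ, 0 < q →
      ‖∫ t in (1 / 2 : ℝ)..2, Complex.exp (((p * t + q * t ^ b : ℝ) : ℂ) * Complex.I)
        * ((χ t : ℝ) : ℂ)‖ ^ 2 ≤ M ^ 2 / |q| := by
    intro p q hq
    have h := van_der_corput (φ := fun t => p * t + q * t ^ b)
      (φ' := fun t => p + q * (b * t ^ (b - 1)))
      (φ'' := fun t => q * (b * (b - 1) * t ^ (b - 2))) (χ := χ) (χ' := deriv χ)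
      (c := c) (d := d) (K₀ := K₀) (K₁ := K₁) (lam := q) (x := 1 / 2) (y := 2)
      (by norm_num) hq hc0 ?_ ?_ (continuousOn_const.mul hcont) ?_ ?_ ?_ cχ'.continuousOn
      (hχs _ (by norm_num)) (hχs _ (by norm_num)) hK₀ hK₁
    · calc _ ≤ (M / Real.sqrt q) ^ 2 := pow_le_pow_left₀ (norm_nonneg _) h 2
        _ = _ := by rw [div_pow, Real.sq_sqrt hq.le, abs_of_pos hq]
    · intro t ht
      have := ((hasDerivAt_id t).const_mul p).add
        ((Real.hasDerivAt_rpow_const (p := b) (Or.inl (hpos t ht).ne')).const_mul q)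
      simpa using! this
    · intro t ht
      have := (((Real.hasDerivAt_rpow_const (p := b - 1) (Or.inl (hpos t ht).ne')).const_mul
        b).const_mul q).const_add p
      convert! this using 1
      rw [show b - 1 - 1 = b - 2 by ring]; ring
    · intro t ht
      rw [mul_comm]
      exact mul_le_mul_of_nonneg_left (hmin ht) hq.le
    · intro t ht
      rw [mul_comm d]
      exact mul_le_mul_of_nonneg_left (hmax ht) hq.le
    · intro t _
      exact ((hχ1.differentiable one_ne_zero) t).hasDerivAt
  refine ⟨M ^ 2, sq_nonneg _, fun p q hq => ?_⟩
  rcases lt_or_gt_of_ne hq with h | h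
  · rw [← abs_neg, ← Complex.norm_conj]
    refine le_of_eq_of_le ?_ (key (-p) (-q) (neg_pos.mpr h))
    congr 2
    rw [← intervalIntegral.intervalIntegral_conj]
    refine intervalIntegral.integral_congr fun t _ => ?_
    simp only [map_mul, ← Complex.exp_conj, Complex.conj_ofReal, Complex.conj_I]
    congr 2
    push_cast
    ring
  · exact key p q h

theorem tauHat_eq_intervalIntegral {b cp cm : ℝ} {χ : ℝ → ℝ}
    (hχs : ∀ t : ℝ, t ∉ Ioo (1 / 2 : ℝ) 2 → χ t = 0) (ξ : ℝ × ℝ) :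
    tauHat b cp cm χ ξ = ∫ t in (1 / 2 : ℝ)..2,
      Complex.exp (((-(2 * Real.pi * ξ.1) * t + -(2 * Real.pi * cp * ξ.2) * t ^ b : ℝ) : ℂ)
        * Complex.I) * ((χ t : ℝ) : ℂ) := by
  rw [tauHat, intervalIntegral.integral_of_le (by norm_num), ← setIntegral_eq_integral_of_forall_compl_eq_zero
    (s := Ioc (1 / 2 : ℝ) 2)]
  · refine setIntegral_congr_fun measurableSet_Ioc fun t ht => ?_
    have : 0 < t := lt_trans (by norm_num) ht.1
    simp only [curve, if_pos this]
    congr 4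
    ring
  · intro t ht
    rw [hχs t fun h => ht (Ioo_subset_Ioc_self h)]
    simp

theorem exists_norm_tauHat_sq_le {b cp : ℝ} (cm : ℝ) (hb : 1 < b) (hcp : cp ≠ 0) {χ : ℝ → ℝ}
    (hχ : ContDiff ℝ (⊤ : ℕ∞) χ) (hχs : ∀ t : ℝ, t ∉ Ioo (1 / 2 : ℝ) 2 → χ t = 0) :
    ∃ C : ℝ, 0 ≤ C ∧ ∀ ξ : ℝ × ℝ, ξ.2 ≠ 0 → ‖tauHat b cp cm χ ξ‖ ^ 2 ≤ C / |ξ.2| := by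
  obtain ⟨C, hC, h⟩ := exists_norm_oscillatory_integral_le hb hχ hχs
  refine ⟨C / (2 * Real.pi * |cp|), by positivity, fun ξ hξ => ?_⟩
  rw [tauHat_eq_intervalIntegral hχs]
  refine (h _ _ (neg_ne_zero.mpr (by positivity))).trans_eq ?_
  rw [abs_neg, abs_mul, abs_mul, abs_of_pos Real.two_pi_pos]
  field_simp

theorem measurable_curve (b cp cm : ℝ) : Measurable (curve b cp cm) := by
  unfold curve
  refine Measurable.ite measurableSet_Ioi (by fun_prop) (Measurable.ite measurableSet_Iio ?_ ?_) <;>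
    fun_prop

theorem contDiff_tauHat {b : ℝ} (cp cm : ℝ) (hb : 1 < b) {χ : ℝ → ℝ}
    (hχ : Continuous χ) (hχs : ∀ t : ℝ, t ∉ Ioo (1 / 2 : ℝ) 2 → χ t = 0) :
    ContDiff ℝ (⊤ : ℕ∞) (tauHat b cp cm χ) := by
  let L : (ℝ × ℝ) →L[ℝ] (ℝ × ℝ) →L[ℝ] ℝ :=
    (ContinuousLinearMap.fst ℝ ℝ ℝ).smulRight (ContinuousLinearMap.fst ℝ ℝ ℝ)
      + (ContinuousLinearMap.snd ℝ ℝ ℝ).smulRight (ContinuousLinearMap.snd ℝ ℝ ℝ)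
  have hΓ : Measurable fun t => (t, curve b cp cm t) :=
    measurable_id.prodMk (measurable_curve b cp cm)
  have hcs : HasCompactSupport χ := HasCompactSupport.intro (isCompact_Icc (a := (1 / 2 : ℝ)) (b := 2))
    fun t ht => hχs t fun h => ht (Ioo_subset_Icc_self h)
  have hmeas : Measurable fun v : ℝ × ℝ => ((χ v.1 : ℝ) : ℂ) := by
    have := hχ.measurable
    fun_prop
  have h := VectorFourier.contDiff_fourierIntegral (N := (⊤ : ℕ∞)) L
    (μ := Measure.map (fun t => (t, curve b cp cm t)) volume)
    (f := fun v => ((χ v.1 : ℝ) : ℂ)) (by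
      intro n _
      rw [integrable_map_measure (by fun_prop) hΓ.aemeasurable]
      have hi := (hχ.integrable_of_hasCompactSupport (μ := volume) hcs).norm.const_mul
        ((max 2 (|cp| * 2 ^ b)) ^ n)
      refine hi.mono' ?_ (Eventually.of_forall fun t => ?_)
      · have := hΓ.norm.pow_const n
        have := hχ.measurable
        exact Measurable.aestronglyMeasurable (by simp only [Function.comp_def]; fun_prop)
      · simp only [Function.comp, Complex.norm_real, norm_mul, norm_pow, norm_norm]
        by_cases ht : t ∈ Ioo (1 / 2 : ℝ) 2
        · have ht0 : 0 < t := lt_trans (by norm_num) ht.1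
          gcongr
          rw [Prod.norm_mk, curve, if_pos ht0, Real.norm_eq_abs, Real.norm_eq_abs, abs_of_pos ht0,
            abs_mul, abs_of_pos (Real.rpow_pos_of_pos ht0 b)]
          gcongr <;> exact ht.2.le
        · simp [hχs t ht])
  convert! h using 1
  ext ξ
  rw [VectorFourier.fourierIntegral, integral_map hΓ.aemeasurable]
  · refine integral_congr_ae (Eventually.of_forall fun t => ?_)
    simp [L, Circle.smul_def, Real.fourierChar_apply, mul_comm]
    left; ring_nf
  · refine Measurable.aestronglyMeasurable ?_
    have : Measurable fun v : ℝ × ℝ => L.toLinearMap₁₂ v ξ := by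
      change Measurable fun v : ℝ × ℝ => v.1 * ξ.1 + v.2 * ξ.2
      fun_prop
    simp only [Circle.smul_def, Real.fourierChar_apply, smul_eq_mul]
    fun_prop

theorem isCompact_norm_sq_le (R : ℝ) : IsCompact {ξ : ℝ × ℝ | ξ.1 ^ 2 + ξ.2 ^ 2 ≤ R ^ 2} := by
  refine ((isCompact_Icc (a := -|R|) (b := |R|)).prod
    (isCompact_Icc (a := -|R|) (b := |R|))).of_isClosed_subset
    (isClosed_le (by fun_prop) continuous_const) fun ξ hξ => ?_
  have h : ξ.1 ^ 2 + ξ.2 ^ 2 ≤ R ^ 2 := hξ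
  exact ⟨abs_le.mp (sq_le_sq.mp (by nlinarith)), abs_le.mp (sq_le_sq.mp (by nlinarith))⟩

/-- A cutoff to a cone around neither coordinate axis is smooth away from the origin, hence its
product with a smooth function vanishing near the origin is smooth. -/
theorem contDiff_mul_cone {ς : ℝ → ℝ} (hς : ContDiff ℝ (⊤ : ℕ∞) ς) {c R : ℝ} (hc : c ≠ 0)
    (hR : ∀ v, ς v ≠ 0 → |v| ≤ R) (hς0 : ς 0 = 0) {g : ℝ × ℝ → ℝ}
    (hg : ContDiff ℝ (⊤ : ℕ∞) g) (hg0 : g =ᶠ[𝓝 0] 0) :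
    ContDiff ℝ (⊤ : ℕ∞) fun ξ => g ξ * ς (ξ.1 / (c * ξ.2)) := by
  rw [contDiff_iff_contDiffAt]
  intro ξ
  by_cases h2 : ξ.2 = 0
  · have hz : (fun ξ : ℝ × ℝ => g ξ * ς (ξ.1 / (c * ξ.2))) =ᶠ[𝓝 ξ] fun _ => 0 := by
      by_cases h1 : ξ.1 = 0
      · have : ξ = 0 := Prod.ext h1 h2
        rw [this]
        filter_upwards [hg0] with x hx
        simp [hx]
      · have ho : IsOpen {x : ℝ × ℝ | R * |c * x.2| < |x.1|} :=
          isOpen_lt (by fun_prop) (by fun_prop)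
        filter_upwards [ho.mem_nhds (by simpa [h2] using h1)] with x hx
        rw [mul_eq_zero]
        right
        by_cases hx2 : x.2 = 0
        · simp [hx2, hς0]
        · by_contra hne
          have h := hR _ hne
          rw [abs_div, div_le_iff₀ (by positivity)] at h
          exact absurd hx (not_lt.mpr h)
    exact contDiffAt_const.congr_of_eventuallyEq hz
  · refine hg.contDiffAt.mul (hς.contDiffAt.comp ξ ?_)
    exact contDiffAt_fst.div (contDiffAt_const.mul contDiffAt_snd) (mul_ne_zero hc h2)

theorem eventually_norm_sq_lt {R : ℝ} (hR : 0 < R) :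
    ∀ᶠ ξ : ℝ × ℝ in 𝓝 0, ξ.1 ^ 2 + ξ.2 ^ 2 < R ^ 2 := by
  have ho : IsOpen {ξ : ℝ × ℝ | ξ.1 ^ 2 + ξ.2 ^ 2 < R ^ 2} := isOpen_lt (by fun_prop) (by fun_prop)
  exact ho.mem_nhds (by simpa using by positivity)

theorem exists_schwartz_coe {a : ℝ × ℝ → ℂ} (ha : ContDiff ℝ (⊤ : ℕ∞) a)
    (hac : HasCompactSupport a) : ∃ G : SchwartzMap (ℝ × ℝ) ℂ, ⇑G = a :=
  ⟨hac.toSchwartzMap ha, rfl⟩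

theorem lintegral_enorm_sq_eq_ofReal (G : SchwartzMap (ℝ × ℝ) ℂ) :
    ∫⁻ x, ‖G x‖ₑ ^ 2 = ENNReal.ofReal (∫ x, ‖G x‖ ^ 2) := by
  rw [ofReal_integral_eq_lintegral_ofReal
    ((G.memLp 2 volume).integrable_norm_pow (by norm_num))
    (Eventually.of_forall fun x => by positivity)]
  simp_rw [ENNReal.ofReal_pow (norm_nonneg _), ofReal_norm]

/-- `L²` bound for a multiplier operator with smooth compactly supported symbol. -/
theorem lintegral_FTinv_mul_FT_sq_le {m : ℝ × ℝ → ℂ} (hm : ContDiff ℝ (⊤ : ℕ∞) m)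
    (hmc : HasCompactSupport m) {B : ℝ} (hB : ∀ ξ, ‖m ξ‖ ^ 2 ≤ B)
    (F : SchwartzMap (ℝ × ℝ) ℂ) :
    (∃ G : SchwartzMap (ℝ × ℝ) ℂ, ⇑G = FTinv fun ξ => m ξ * FT F ξ) ∧
    ∫⁻ x, ‖FTinv (fun ξ => m ξ * FT F ξ) x‖ₑ ^ 2 ≤ ENNReal.ofReal B * ∫⁻ x, ‖F x‖ₑ ^ 2 := by
  have hB0 : 0 ≤ B := (sq_nonneg _).trans (hB 0)
  obtain ⟨G, hG, hGn⟩ := exists_schwartz_FT F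
  obtain ⟨H, hH⟩ := exists_schwartz_coe (hm.mul (G.smooth _)) (hmc.mul_right (f' := G))
  obtain ⟨K, hK, hKn⟩ := exists_schwartz_FTinv H
  have hHm : (fun ξ => m ξ * FT F ξ) = H := by rw [hH, hG]
  rw [hHm, ← hK]
  refine ⟨⟨K, rfl⟩, ?_⟩
  rw [lintegral_enorm_sq_eq_ofReal, hKn, ← lintegral_enorm_sq_eq_ofReal,
    lintegral_enorm_sq_eq_ofReal F, ← hGn, ← lintegral_enorm_sq_eq_ofReal,
    ← lintegral_const_mul' _ _ ENNReal.ofReal_ne_top]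
  refine lintegral_mono fun ξ => ?_
  simp only [hH]
  rw [enorm_mul, mul_pow]
  gcongr
  rw [← ofReal_norm, ← ENNReal.ofReal_pow (norm_nonneg _)]
  exact ENNReal.ofReal_le_ofReal (hB ξ)

theorem lintegral_FTinv_ne_top {a : ℝ × ℝ → ℂ} (ha : ContDiff ℝ (⊤ : ℕ∞) a)
    (hac : HasCompactSupport a) : ∫⁻ x, ‖FTinv a x‖ₑ ≠ ∞ := by
  obtain ⟨G, hG⟩ := exists_schwartz_coe ha hac
  obtain ⟨H, hH, -⟩ := exists_schwartz_FTinv G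
  rw [← hG, ← hH]
  exact H.integrable.2.ne

/-- The order zero symbol `ζ_ℓ(ξ) (1 - η(ξ)) ς(ξ₁ / (c ξ₂))`. -/
def coneSymbol (c : ℝ) (η : ℝ × ℝ → ℝ) (ς : ℝ → ℝ) (ζ : ℝ × ℝ → ℝ) (l : ℕ) (ξ : ℝ × ℝ) : ℝ :=
  zl ζ l ξ * (1 - η ξ) * ς (ξ.1 / (c * ξ.2))

section ConeSymbol

variable {c R : ℝ} {η : ℝ × ℝ → ℝ} {ς : ℝ → ℝ} {ζ : ℝ × ℝ → ℝ}

theorem hasCompactSupport_of_forall_le {ζ : ℝ × ℝ → ℝ}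
    (hζsupp : ∀ ξ : ℝ × ℝ, (4 : ℝ) ≤ ξ.1 ^ 2 + ξ.2 ^ 2 → ζ ξ = 0) : HasCompactSupport ζ :=
  HasCompactSupport.intro (isCompact_norm_sq_le 2) fun ξ hξ => hζsupp ξ (by
    simp only [Set.mem_ofPred_eq, not_le] at hξ
    linarith)

theorem hasCompactSupport_zl (hζsupp : ∀ ξ : ℝ × ℝ, (4 : ℝ) ≤ ξ.1 ^ 2 + ξ.2 ^ 2 → ζ ξ = 0)
    (l : ℕ) : HasCompactSupport (zl ζ l) := by
  have h := hasCompactSupport_of_forall_le hζsupp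
  have h1 : (2 : ℝ) ^ (-(l : ℝ)) ≠ 0 := by positivity
  have h2 : (2 : ℝ) ^ (1 - (l : ℝ)) ≠ 0 := by positivity
  exact (h.comp_smul h1).sub (h.comp_smul h2)

theorem hasCompactSupport_coneSymbol
    (hζsupp : ∀ ξ : ℝ × ℝ, (4 : ℝ) ≤ ξ.1 ^ 2 + ξ.2 ^ 2 → ζ ξ = 0) (l : ℕ) :
    HasCompactSupport (coneSymbol c η ς ζ l) :=
  ((hasCompactSupport_zl hζsupp l).mul_right (f' := fun ξ => 1 - η ξ)).mul_right

theorem contDiff_coneSymbol (hς : ContDiff ℝ (⊤ : ℕ∞) ς) (hc : c ≠ 0)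
    (hR : ∀ v, ς v ≠ 0 → |v| ≤ R) (hς0 : ς 0 = 0) (hζ : ContDiff ℝ (⊤ : ℕ∞) ζ)
    (hη : ContDiff ℝ (⊤ : ℕ∞) η)
    (hηone : ∀ ξ : ℝ × ℝ, ξ.1 ^ 2 + ξ.2 ^ 2 ≤ (50 : ℝ) ^ 2 → η ξ = 1) (l : ℕ) :
    ContDiff ℝ (⊤ : ℕ∞) (coneSymbol c η ς ζ l) := by
  refine contDiff_mul_cone hς hc hR hς0 (g := fun ξ => zl ζ l ξ * (1 - η ξ)) ?_ ?_
  · unfold zl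
    fun_prop
  · filter_upwards [eventually_norm_sq_lt (by norm_num : (0 : ℝ) < 50)] with ξ hξ
    simp [hηone ξ hξ.le]

theorem norm_sq_lower_of_zl_ne_zero
    (hζone : ∀ ξ : ℝ × ℝ, ξ.1 ^ 2 + ξ.2 ^ 2 ≤ ((5 : ℝ) / 4) ^ 2 → ζ ξ = 1) {l : ℕ} {ξ : ℝ × ℝ}
    (h : zl ζ l ξ ≠ 0) : 25 / 64 * ((2 : ℝ) ^ l) ^ 2 < ξ.1 ^ 2 + ξ.2 ^ 2 := by
  by_contra hle
  rw [not_lt] at hle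
  have hp : (0 : ℝ) < 2 ^ l := by positivity
  have e1 : (2 : ℝ) ^ (-(l : ℝ)) = (2 ^ l)⁻¹ := by
    rw [Real.rpow_neg zero_le_two, Real.rpow_natCast]
  have e2 : (2 : ℝ) ^ (1 - (l : ℝ)) = 2 * (2 ^ l)⁻¹ := by
    rw [Real.rpow_sub two_pos, Real.rpow_natCast, Real.rpow_one]; rfl
  have hle' : (ξ.1 ^ 2 + ξ.2 ^ 2) * ((2 : ℝ) ^ l)⁻¹ ^ 2 ≤ 25 / 64 := by
    rw [inv_pow, ← div_eq_mul_inv, div_le_iff₀ (by positivity)]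
    exact hle
  apply h
  rw [zl, e1, e2, hζone, hζone, sub_self]
  · simp only [Prod.smul_fst, Prod.smul_snd, smul_eq_mul]
    nlinarith
  · simp only [Prod.smul_fst, Prod.smul_snd, smul_eq_mul]
    nlinarith [sq_nonneg (ξ.1 * ((2 : ℝ) ^ l)⁻¹), sq_nonneg (ξ.2 * ((2 : ℝ) ^ l)⁻¹)]

theorem coneSymbol_eq_of_large
    (hηsupp : ∀ ξ : ℝ × ℝ, (100 : ℝ) ^ 2 < ξ.1 ^ 2 + ξ.2 ^ 2 → η ξ = 0)
    (hζone : ∀ ξ : ℝ × ℝ, ξ.1 ^ 2 + ξ.2 ^ 2 ≤ ((5 : ℝ) / 4) ^ 2 → ζ ξ = 1) {l : ℕ} (hl : 8 ≤ l)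
    (ξ : ℝ × ℝ) : coneSymbol c η ς ζ l ξ
      = coneSymbol c 0 ς ζ 0 ((2 : ℝ) ^ (-(l : ℝ)) * ξ.1, (2 : ℝ) ^ (-(l : ℝ)) * ξ.2) := by
  have hr : (2 : ℝ) ^ (-(l : ℝ)) ≠ 0 := by positivity
  have hz : zl ζ 0 ((2 : ℝ) ^ (-(l : ℝ)) * ξ.1, (2 : ℝ) ^ (-(l : ℝ)) * ξ.2) = zl ζ l ξ := by
    simp only [zl, Prod.smul_def, smul_eq_mul, Nat.cast_zero, neg_zero, Real.rpow_zero, one_mul,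
      sub_zero, Real.rpow_one, ← mul_assoc]
    rw [sub_eq_add_neg 1 (l : ℝ), Real.rpow_add two_pos, Real.rpow_one]
  have hq : (2 : ℝ) ^ (-(l : ℝ)) * ξ.1 / (c * ((2 : ℝ) ^ (-(l : ℝ)) * ξ.2)) = ξ.1 / (c * ξ.2) := by
    rw [mul_left_comm, mul_div_mul_left _ _ hr]
  simp only [coneSymbol, hz, hq, Pi.zero_apply, sub_zero, mul_one]
  by_cases h : zl ζ l ξ = 0
  · simp [h]
  · have h1 := norm_sq_lower_of_zl_ne_zero hζone h
    have h2 : (2 : ℝ) ^ 8 ≤ 2 ^ l := pow_le_pow_right₀ one_le_two hl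
    rw [hηsupp ξ (by nlinarith)]
    ring

theorem exists_lintegral_FTinv_coneSymbol_le (hς : ContDiff ℝ (⊤ : ℕ∞) ς) (hc : c ≠ 0)
    (hR : ∀ v, ς v ≠ 0 → |v| ≤ R) (hς0 : ς 0 = 0) (hζ : ContDiff ℝ (⊤ : ℕ∞) ζ)
    (hη : ContDiff ℝ (⊤ : ℕ∞) η)
    (hηone : ∀ ξ : ℝ × ℝ, ξ.1 ^ 2 + ξ.2 ^ 2 ≤ (50 : ℝ) ^ 2 → η ξ = 1)
    (hηsupp : ∀ ξ : ℝ × ℝ, (100 : ℝ) ^ 2 < ξ.1 ^ 2 + ξ.2 ^ 2 → η ξ = 0)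
    (hζsupp : ∀ ξ : ℝ × ℝ, (4 : ℝ) ≤ ξ.1 ^ 2 + ξ.2 ^ 2 → ζ ξ = 0)
    (hζone : ∀ ξ : ℝ × ℝ, ξ.1 ^ 2 + ξ.2 ^ 2 ≤ ((5 : ℝ) / 4) ^ 2 → ζ ξ = 1) :
    ∃ C : ℝ≥0∞, C ≠ ∞ ∧ ∀ l : ℕ,
      ∫⁻ x, ‖FTinv (fun ξ => ((coneSymbol c η ς ζ l ξ : ℝ) : ℂ)) x‖ₑ ≤ C := by
  have hfin : ∀ l : ℕ, ∫⁻ x, ‖FTinv (fun ξ => ((coneSymbol c η ς ζ l ξ : ℝ) : ℂ)) x‖ₑ ≠ ∞ :=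
    fun l => lintegral_FTinv_ne_top
      (Complex.ofRealCLM.contDiff.comp (contDiff_coneSymbol hς hc hR hς0 hζ hη hηone l))
      ((hasCompactSupport_coneSymbol hζsupp l).comp_left Complex.ofReal_zero)
  have hsm : ContDiff ℝ (⊤ : ℕ∞) (coneSymbol c 0 ς ζ 0) := by
    refine contDiff_mul_cone hς hc hR hς0 (g := fun ξ => zl ζ 0 ξ * (1 - 0)) ?_ ?_
    · unfold zl
      fun_prop
    · filter_upwards [eventually_norm_sq_lt (by norm_num : (0 : ℝ) < 5 / 8)] with ξ hξ
      by_contra h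
      have := norm_sq_lower_of_zl_ne_zero hζone (l := 0) (ξ := ξ) (by simpa using h)
      norm_num at hξ this
      linarith
  have hfin₀ := lintegral_FTinv_ne_top (Complex.ofRealCLM.contDiff.comp hsm)
    ((hasCompactSupport_coneSymbol (c := c) (η := 0) (ς := ς) hζsupp 0).comp_left Complex.ofReal_zero)
  refine ⟨(∑ l ∈ Finset.range 8, ∫⁻ x, ‖FTinv (fun ξ => ((coneSymbol c η ς ζ l ξ : ℝ) : ℂ)) x‖ₑ)
    + ∫⁻ x, ‖FTinv (fun ξ => ((coneSymbol c 0 ς ζ 0 ξ : ℝ) : ℂ)) x‖ₑ,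
    ENNReal.add_ne_top.mpr ⟨ENNReal.sum_ne_top.mpr fun l _ => hfin l, hfin₀⟩, fun l => ?_⟩
  rcases lt_or_ge l 8 with hl | hl
  · exact (Finset.single_le_sum (f := fun l => ∫⁻ x, ‖FTinv (fun ξ =>
      ((coneSymbol c η ς ζ l ξ : ℝ) : ℂ)) x‖ₑ) (fun _ _ => zero_le)
      (Finset.mem_range.mpr hl)).trans le_self_add
  · have hr : (2 : ℝ) ^ (-(l : ℝ)) ≠ 0 := by positivity
    simp_rw [coneSymbol_eq_of_large (c := c) (ς := ς) hηsupp hζone hl]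
    rw [lintegral_FTinv_comp_diag hr hr (fun ξ => ((coneSymbol c 0 ς ζ 0 ξ : ℝ) : ℂ))]
    exact le_add_self

theorem exists_coneSymbol_mul_sq_le (hς : Continuous ς) (hc : c ≠ 0)
    (hR : ∀ v, ς v ≠ 0 → |v| ≤ R) (hς0 : ς 0 = 0) (hζ : Continuous ζ) (hη : Continuous η)
    (hηsupp : ∀ ξ : ℝ × ℝ, (100 : ℝ) ^ 2 < ξ.1 ^ 2 + ξ.2 ^ 2 → η ξ = 0)
    (hζsupp : ∀ ξ : ℝ × ℝ, (4 : ℝ) ≤ ξ.1 ^ 2 + ξ.2 ^ 2 → ζ ξ = 0)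
    (hζone : ∀ ξ : ℝ × ℝ, ξ.1 ^ 2 + ξ.2 ^ 2 ≤ ((5 : ℝ) / 4) ^ 2 → ζ ξ = 1)
    {τ : ℝ × ℝ → ℂ} {D : ℝ} (hD : 0 ≤ D) (hτ : ∀ ξ : ℝ × ℝ, ξ.2 ≠ 0 → ‖τ ξ‖ ^ 2 ≤ D / |ξ.2|) :
    ∃ C : ℝ, 0 ≤ C ∧ ∀ (l : ℕ) (ξ : ℝ × ℝ),
      ‖((coneSymbol c η ς ζ l ξ : ℝ) : ℂ) * τ ξ‖ ^ 2 ≤ C * (2 ^ l)⁻¹ := by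
  have hηc : HasCompactSupport η := HasCompactSupport.intro (isCompact_norm_sq_le 100)
    fun ξ hξ => hηsupp ξ (by simpa using hξ)
  have hςc : HasCompactSupport ς := HasCompactSupport.intro (isCompact_Icc (a := -R) (b := R))
    fun v hv => by
      by_contra h
      exact hv (abs_le.mp (hR v h))
  obtain ⟨Mζ, hMζ⟩ := hζ.bounded_above_of_compact_support (hasCompactSupport_of_forall_le hζsupp)
  obtain ⟨Mη, hMη⟩ := hη.bounded_above_of_compact_support hηc
  obtain ⟨Mς, hMς⟩ := hς.bounded_above_of_compact_support hςc
  set N := (Mζ + Mζ) * (1 + Mη) * Mς with hN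
  have hMζ0 : 0 ≤ Mζ := (norm_nonneg _).trans (hMζ 0)
  have hMη0 : 0 ≤ Mη := (norm_nonneg _).trans (hMη 0)
  have hsup : ∀ l ξ, |coneSymbol c η ς ζ l ξ| ≤ N := by
    intro l ξ
    rw [coneSymbol, abs_mul, abs_mul, hN, zl]
    gcongr
    · exact (norm_sub_le _ _).trans (add_le_add (hMζ _) (hMζ _))
    · refine (norm_sub_le (1 : ℝ) _).trans ?_
      rw [norm_one]
      gcongr
      exact hMη _
    · exact hMς _
  set E := R * |c| with hE
  refine ⟨N ^ 2 * (D * (8 / 5 * Real.sqrt (E ^ 2 + 1))), by positivity, fun l ξ => ?_⟩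
  by_cases h : coneSymbol c η ς ζ l ξ = 0
  · rw [h, Complex.ofReal_zero, zero_mul, norm_zero, zero_pow two_ne_zero]
    positivity
  have h1 : zl ζ l ξ ≠ 0 := fun h' => h (by simp [coneSymbol, h'])
  have h2 : ς (ξ.1 / (c * ξ.2)) ≠ 0 := fun h' => h (by simp [coneSymbol, h'])
  have h3 : ξ.2 ≠ 0 := fun h' => h2 (by simp [h', hς0])
  have h4 := hR _ h2
  rw [abs_div, div_le_iff₀ (by positivity), abs_mul, ← mul_assoc] at h4
  have h5 := norm_sq_lower_of_zl_ne_zero hζone h1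
  have h6 : ξ.1 ^ 2 ≤ E ^ 2 * ξ.2 ^ 2 := by
    rw [← sq_abs ξ.1, ← sq_abs ξ.2, ← mul_pow]
    exact pow_le_pow_left₀ (abs_nonneg _) h4 2
  have h7 : 5 / 8 * 2 ^ l ≤ Real.sqrt (E ^ 2 + 1) * |ξ.2| := by
    refine (sq_le_sq₀ (by positivity) (by positivity)).mp ?_
    rw [mul_pow, mul_pow, Real.sq_sqrt (by positivity), sq_abs]
    nlinarith
  have h8 : D / |ξ.2| ≤ D * (8 / 5 * Real.sqrt (E ^ 2 + 1)) * (2 ^ l)⁻¹ := by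
    rw [← div_eq_mul_inv, div_le_div_iff₀ (by positivity) (by positivity)]
    have := mul_le_mul_of_nonneg_left h7 hD
    linarith
  rw [norm_mul, mul_pow, mul_assoc (N ^ 2)]
  refine mul_le_mul ?_ ((hτ ξ h3).trans h8) (by positivity) (by positivity)
  rw [Complex.norm_real]
  exact pow_le_pow_left₀ (norm_nonneg _) (hsup l ξ) 2

end ConeSymbol

theorem integrable_continuous_FTinv_of_hasCompactSupport {a : ℝ × ℝ → ℂ}
    (ha : ContDiff ℝ (⊤ : ℕ∞) a) (hac : HasCompactSupport a) :
    Integrable a ∧ Continuous (FTinv a) := by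
  obtain ⟨G, hG⟩ := exists_schwartz_coe ha hac
  obtain ⟨H, hH, -⟩ := exists_schwartz_FTinv G
  rw [← hG, ← hH]
  exact ⟨G.integrable, H.continuous⟩

theorem FT_add {f g : ℝ × ℝ → ℂ} (hf : Integrable f) (hg : Integrable g) (ξ : ℝ × ℝ) :
    FT (fun x => f x + g x) ξ = FT f ξ + FT g ξ := by
  have h : ∀ {f : ℝ × ℝ → ℂ}, Integrable f → Integrable fun x : ℝ × ℝ =>
      Complex.exp ((((-(2 * Real.pi * (x.1 * ξ.1 + x.2 * ξ.2))) : ℝ) : ℂ) * Complex.I) * f x :=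
    fun hf => hf.bdd_mul (c := 1) (Continuous.aestronglyMeasurable (by fun_prop))
      (Eventually.of_forall fun x => (Complex.norm_exp_ofReal_mul_I _).le)
  rw [FT, FT, FT, ← integral_add (h hf) (h hg)]
  simp_rw [mul_add]

theorem FTinv_add {f g : ℝ × ℝ → ℂ} (hf : Integrable f) (hg : Integrable g) (x : ℝ × ℝ) :
    FTinv (fun ξ => f ξ + g ξ) x = FTinv f x + FTinv g x := by
  have h : ∀ {f : ℝ × ℝ → ℂ}, Integrable f → Integrable fun ξ : ℝ × ℝ =>
      Complex.exp (((2 * Real.pi * (x.1 * ξ.1 + x.2 * ξ.2) : ℝ) : ℂ) * Complex.I) * f ξ :=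
    fun hf => hf.bdd_mul (c := 1) (Continuous.aestronglyMeasurable (by fun_prop))
      (Eventually.of_forall fun ξ => (Complex.norm_exp_ofReal_mul_I _).le)
  rw [FTinv, FTinv, FTinv, ← integral_add (h hf) (h hg)]
  simp_rw [mul_add]

theorem FTinv_mul_FT_add {m : ℝ × ℝ → ℂ} (hm : ContDiff ℝ (⊤ : ℕ∞) m)
    (hmc : HasCompactSupport m) (F G : SchwartzMap (ℝ × ℝ) ℂ) :
    FTinv (fun ξ => m ξ * FT (fun x => F x + G x) ξ)
      = (FTinv fun ξ => m ξ * FT F ξ) + FTinv fun ξ => m ξ * FT G ξ := by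
  have h : ∀ F : SchwartzMap (ℝ × ℝ) ℂ, Integrable fun ξ => m ξ * FT F ξ := by
    intro F
    obtain ⟨G, hG, -⟩ := exists_schwartz_FT F
    obtain ⟨H, hH⟩ := exists_schwartz_coe (hm.mul (G.smooth _)) (hmc.mul_right (f' := G))
    rw [← hG]
    exact hH ▸ H.integrable
  ext x
  simp_rw [FT_add F.integrable G.integrable, mul_add]
  exact FTinv_add (h F) (h G) x

/-- `L¹` bound for the multiplier operator with symbol `a · τ̂` precomposed with a dilation. -/
theorem lintegral_FTinv_mul_tauHat_mul_FT_le {b cp cm : ℝ} {χ : ℝ → ℝ} (hχ : Integrable χ)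
    {a : ℝ × ℝ → ℂ} (ha : ContDiff ℝ (⊤ : ℕ∞) a) (hac : HasCompactSupport a)
    {α β : ℝ} (hα : α ≠ 0) (hβ : β ≠ 0) {F : ℝ × ℝ → ℂ} (hF : Integrable F) :
    ∫⁻ x, ‖FTinv (fun ξ => a (α * ξ.1, β * ξ.2) * tauHat b cp cm χ (α * ξ.1, β * ξ.2)
      * FT F ξ) x‖ₑ ≤ (∫⁻ t, ‖χ t‖ₑ) * (∫⁻ x, ‖F x‖ₑ) * ∫⁻ x, ‖FTinv a x‖ₑ := by
  have hχ' : Integrable fun t => ((χ t : ℝ) : ℂ) := hχ.ofReal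
  have hmul : (fun ξ : ℝ × ℝ => a (α * ξ.1, β * ξ.2) * tauHat b cp cm χ (α * ξ.1, β * ξ.2)
      * FT F ξ) = fun ξ => a (α * ξ.1, β * ξ.2) * ∫ s : ℝ × (ℝ × ℝ), Complex.exp ((((-(2 * Real.pi *
      ((α * s.1 + s.2.1) * ξ.1 + (β * curve b cp cm s.1 + s.2.2) * ξ.2))) : ℝ) : ℂ) * Complex.I)
        * (((χ s.1 : ℝ) : ℂ) * F s.2) ∂(volume.prod volume) := by
    ext ξ
    rw [mul_assoc, tauHat, FT, ← integral_prod_mul]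
    congr 1
    refine integral_congr_ae (Eventually.of_forall fun s => ?_)
    simp only
    rw [mul_mul_mul_comm, ← Complex.exp_add, ← add_mul, ← Complex.ofReal_add]
    congr 4
    ring
  have hsm : ContDiff ℝ (⊤ : ℕ∞) fun ξ : ℝ × ℝ => a (α * ξ.1, β * ξ.2) :=
    ha.comp (by fun_prop)
  obtain ⟨h1, h2⟩ := integrable_continuous_FTinv_of_hasCompactSupport hsm
    (hac.comp_homeomorph (diagHomeo α β hα hβ))
  rw [hmul]
  refine (lintegral_FTinv_mul_le (volume.prod volume) (hχ'.mul_prod hF)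
    (P := fun s : ℝ × (ℝ × ℝ) => (α * s.1 + s.2.1, β * curve b cp cm s.1 + s.2.2))
    ?_ h1 h2).trans_eq ?_
  · have := measurable_curve b cp cm
    fun_prop
  · rw [lintegral_FTinv_comp_diag hα hβ]
    simp_rw [enorm_mul]
    rw [lintegral_prod_mul hχ'.1.enorm hF.1.enorm]
    simp_rw [← ofReal_norm, Complex.norm_real]

theorem Ajl_eq_FTinv (b cp cm : ℝ) (χ : ℝ → ℝ) (η : ℝ × ℝ → ℝ) (ςm : ℝ → ℝ) (ζ : ℝ × ℝ → ℝ)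
    (j : ℤ) (l : ℕ) (u : ℝ) (f : ℝ × ℝ → ℝ) :
    Ajl b cp cm χ η ςm ζ j l u f = FTinv fun ξ =>
      ((coneSymbol cp η ςm ζ l ((2 : ℝ) ^ (-(j : ℝ)) * ξ.1,
          (2 : ℝ) ^ (-((j : ℝ) * b)) * u * ξ.2) : ℝ) : ℂ)
        * tauHat b cp cm χ ((2 : ℝ) ^ (-(j : ℝ)) * ξ.1, (2 : ℝ) ^ (-((j : ℝ) * b)) * u * ξ.2)
        * FT (fun x => ((f x : ℝ) : ℂ)) ξ := by
  rw [Ajl]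
  congr 1
  ext ξ
  simp only [rhoHat, coneSymbol, dil, mul_assoc ((2 : ℝ) ^ (-((j : ℝ) * b))) u]
  push_cast
  ring

/-- Passing from `L^p` integrals with `p = 1 + s` to `L^p` norms. -/
theorem eLpNorm_le_of_lintegral_rpow_le {g : ℝ × ℝ → ℂ} {f : ℝ × ℝ → ℝ} {K : ℝ} (hK : 1 ≤ K)
    {l : ℕ} {p : ℝ} (hp : 1 ≤ p)
    (h : ∫⁻ x, ‖g x‖ₑ ^ p ≤ ENNReal.ofReal (K * ((2 ^ l)⁻¹ : ℝ) ^ (p - 1)) * ∫⁻ x, ‖f x‖ₑ ^ p) :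
    eLpNorm g (eN p) volume
      ≤ ENNReal.ofReal (K * (2 : ℝ) ^ (-(l : ℝ) * (1 - 1 / p))) * eLpNorm f (eN p) volume := by
  have hp0 : 0 < p := by linarith
  have hne : eN p ≠ 0 := by simpa [eN] using hp0
  have hr : (eN p).toReal = p := ENNReal.toReal_ofReal hp0.le
  rw [eLpNorm_eq_lintegral_rpow_enorm_toReal hne ENNReal.ofReal_ne_top,
    eLpNorm_eq_lintegral_rpow_enorm_toReal hne ENNReal.ofReal_ne_top, hr]
  refine (ENNReal.rpow_le_rpow h (by positivity)).trans ?_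
  rw [ENNReal.mul_rpow_of_nonneg _ _ (by positivity),
    ENNReal.ofReal_rpow_of_nonneg (by positivity) (by positivity)]
  gcongr
  rw [Real.mul_rpow (by positivity) (by positivity), ← Real.rpow_natCast, ← Real.rpow_neg zero_le_two,
    ← Real.rpow_mul zero_le_two, ← Real.rpow_mul zero_le_two]
  have he : -(l : ℝ) * (p - 1) * (1 / p) = -(l : ℝ) * (1 - 1 / p) := by field_simp
  rw [he]
  gcongr
  refine (Real.rpow_le_rpow_of_exponent_le hK ((div_le_one hp0).mpr hp)).trans_eq (Real.rpow_one K)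

theorem statement17 (b cp cm : ℝ) (hb : 1 < b) (hcp : cp ≠ 0) (hcm : cm ≠ 0)
    (χp : ℝ → ℝ) (hχsm : ContDiff ℝ (⊤ : ℕ∞) χp)
    (hχsupp : ∀ t : ℝ, t ∉ Ioo (1/2 : ℝ) 2 → χp t = 0)
    (hχsum : ∀ t : ℝ, 0 < t → HasSum (fun j : ℤ => χp ((2:ℝ) ^ j * t)) 1)
    (η : ℝ × ℝ → ℝ) (hηsm : ContDiff ℝ (⊤ : ℕ∞) η)
    (hηsupp : ∀ ξ : ℝ × ℝ, (100:ℝ)^2 < ξ.1^2 + ξ.2^2 → η ξ = 0)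
    (hηone : ∀ ξ : ℝ × ℝ, ξ.1^2 + ξ.2^2 ≤ (50:ℝ)^2 → η ξ = 1)
    (ςm : ℝ → ℝ) (hςmsm : ContDiff ℝ (⊤ : ℕ∞) ςm)
    (hςmsupp : ∀ v : ℝ, v ∉ Ioo (-(b * (4:ℝ) ^ (b-1))) (-(b * (4:ℝ)⁻¹ ^ (b-1))) → ςm v = 0)
    (hςmone : ∀ v ∈ Icc (-(b * ((7:ℝ)/2) ^ (b-1))) (-(b * ((2:ℝ)/7) ^ (b-1))), ςm v = 1)
    (ζ : ℝ × ℝ → ℝ) (hζsm : ContDiff ℝ (⊤ : ℕ∞) ζ)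
    (hζsupp : ∀ ξ : ℝ × ℝ, (4:ℝ) ≤ ξ.1^2 + ξ.2^2 → ζ ξ = 0)
    (hζone : ∀ ξ : ℝ × ℝ, ξ.1^2 + ξ.2^2 ≤ ((5:ℝ)/4)^2 → ζ ξ = 1) :
    ∃ C : ℝ, ∀ p : ℝ, 1 ≤ p → p ≤ 2 → ∀ l : ℕ, 1 ≤ l → ∀ j : ℤ, ∀ u : ℝ, 0 < u →
      ∀ f : SchwartzMap (ℝ × ℝ) ℝ,
        eLpNorm (Ajl b cp cm χp η ςm ζ j l u ⇑f) (eN p) volume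
          ≤ ENNReal.ofReal (C * (2:ℝ) ^ (-(l : ℝ) * (1 - 1 / p)))
              * eLpNorm ⇑f (eN p) volume := by
  have hχi : Integrable χp := hχsm.continuous.integrable_of_hasCompactSupport
    (HasCompactSupport.intro (isCompact_Icc (a := (1 / 2 : ℝ)) (b := 2))
      fun t ht => hχsupp t fun h => ht (Ioo_subset_Icc_self h))
  have hb0 : 0 < b := by linarith
  have hR : ∀ v, ςm v ≠ 0 → |v| ≤ b * (4 : ℝ) ^ (b - 1) := by
    intro v hv
    have hv' := not_not.mp fun h => hv (hςmsupp v h)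
    have : 0 < b * (4 : ℝ)⁻¹ ^ (b - 1) := by positivity
    rw [abs_of_neg (by linarith [hv'.2])]
    linarith [hv'.1]
  have hς0 : ςm 0 = 0 := hςmsupp 0 fun h => by
    have : 0 < b * (4 : ℝ)⁻¹ ^ (b - 1) := by positivity
    linarith [h.2]
  obtain ⟨K, hK, hK1⟩ := exists_lintegral_FTinv_coneSymbol_le hςmsm hcp hR hς0 hζsm hηsm hηone
    hηsupp hζsupp hζone
  obtain ⟨D, hD, hτ⟩ := exists_norm_tauHat_sq_le (b := b) cm hb hcp hχsm hχsupp
  obtain ⟨E, hE, hE2⟩ := exists_coneSymbol_mul_sq_le hςmsm.continuous hcp hR hς0 hζsm.continuous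
    hηsm.continuous hηsupp hζsupp hζone hD hτ
  set K₁ : ℝ≥0∞ := (∫⁻ t, ‖χp t‖ₑ) * K with hK₁
  have hK₁top : K₁ ≠ ∞ := ENNReal.mul_ne_top hχi.2.ne hK
  set C : ℝ := 1 + K₁.toReal + E with hC
  have hK₁0 : 0 ≤ K₁.toReal := ENNReal.toReal_nonneg
  refine ⟨10 * C, fun p hp1 hp2 l _ j u hu f => ?_⟩
  have hα : (2 : ℝ) ^ (-(j : ℝ)) ≠ 0 := by positivity
  have hβ : (2 : ℝ) ^ (-((j : ℝ) * b)) * u ≠ 0 := by positivity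
  set a : ℝ × ℝ → ℂ := fun ξ => ((coneSymbol cp η ςm ζ l ξ : ℝ) : ℂ)
  have ha : ContDiff ℝ (⊤ : ℕ∞) a := Complex.ofRealCLM.contDiff.comp
    (contDiff_coneSymbol hςmsm hcp hR hς0 hζsm hηsm hηone l)
  have hac : HasCompactSupport a :=
    (hasCompactSupport_coneSymbol hζsupp l).comp_left Complex.ofReal_zero
  set m : ℝ × ℝ → ℂ := fun ξ =>
    a ((2 : ℝ) ^ (-(j : ℝ)) * ξ.1, (2 : ℝ) ^ (-((j : ℝ) * b)) * u * ξ.2)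
      * tauHat b cp cm χp ((2 : ℝ) ^ (-(j : ℝ)) * ξ.1, (2 : ℝ) ^ (-((j : ℝ) * b)) * u * ξ.2)
  have hm : ContDiff ℝ (⊤ : ℕ∞) m :=
    (ha.mul (contDiff_tauHat cp cm hb hχsm.continuous hχsupp)).comp
      (g := fun ξ => a ξ * tauHat b cp cm χp ξ) (by fun_prop)
  have hmc : HasCompactSupport m := (hac.comp_homeomorph (diagHomeo _ _ hα hβ)).mul_right
  let F : SchwartzMap (ℝ × ℝ) ℝ → SchwartzMap (ℝ × ℝ) ℂ :=
    fun f => f.postcompCLM Complex.ofRealCLM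
  have hA : ∀ f : SchwartzMap (ℝ × ℝ) ℝ,
      Ajl b cp cm χp η ςm ζ j l u f = FTinv fun ξ => m ξ * FT (F f) ξ :=
    fun f => Ajl_eq_FTinv b cp cm χp η ςm ζ j l u f
  have hF : ∀ (f : SchwartzMap (ℝ × ℝ) ℝ) x, ‖F f x‖ₑ = ‖f x‖ₑ := by
    intro f x
    rw [← ofReal_norm, ← ofReal_norm]
    exact congrArg ENNReal.ofReal (Complex.norm_real (f x))
  have hL2 := fun f => lintegral_FTinv_mul_FT_sq_le hm hmc (fun _ => hE2 l _) (F f)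
  have h := lintegral_rpow_le_of_L1_L2 (T := Ajl b cp cm χp η ςm ζ j l u) (C := C)
    (δ := ((2 : ℝ) ^ l)⁻¹) (by linarith) (by positivity) ?_ ?_ ?_ ?_
    (sub_nonneg.mpr hp1) (by linarith) f
  · rw [add_sub_cancel] at h
    exact eLpNorm_le_of_lintegral_rpow_le (by linarith) hp1 h
  · intro f g
    have hFfg : ⇑(F (f + g)) = fun x => F f x + F g x :=
      funext fun x => Complex.ofReal_add (f x) (g x)
    rw [hA, hA, hA, ← FTinv_mul_FT_add hm hmc, hFfg]
  · intro f
    obtain ⟨⟨G, hG⟩, -⟩ := hL2 f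
    rw [hA, ← hG]
    exact G.continuous.measurable
  · intro f
    rw [hA]
    refine (lintegral_FTinv_mul_tauHat_mul_FT_le hχi ha hac hα hβ (F f).integrable).trans ?_
    simp_rw [hF]
    rw [mul_right_comm]
    gcongr
    refine (mul_le_mul_right (hK1 l) _).trans ?_
    rw [← hK₁, ← ENNReal.ofReal_toReal hK₁top]
    exact ENNReal.ofReal_le_ofReal (by linarith)
  · intro f
    rw [hA]
    refine (hL2 f).2.trans ?_
    simp_rw [hF]
    gcongr
    linarith

end
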